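/- arXiv:0904.1150 — 2 statements merged into one kernel-verified Lean document; each statement's English description precedes it below -/
import Mathlib

section
/- Channel determination of the output block (equation (eqnY)): For a non-controllable FSC with a source in 𝒫(u,u) (u ≥ 1), for every t with u ≤ t ≤ N and every (x^t, s_0^{t-u}, y^{t-u}) with Pr(X^t = x^t, S_0^{t-u} = s_0^{t-u}, Y^{t-u} = y^{t-u}) > 0 and every y_{t-u+1}^t ∈ 𝒴^u: Pr(Y_{t-u+1}^t = y_{t-u+1}^t | X^t = x^t, S_0^{t-u} = s_0^{t-u}, Y^{t-u} = y^{t-u}) = Σ_{s_{t-u+1}^t ∈ 𝒮^u} ∏_{τ=t-u+1}^t W(y_τ, s_τ | x_τ, s_{τ-1}). In particular this conditional probability is completely determined by the channel transition law and does not depend on the source. -/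
/-!
Common framework: finite-state channels (FSCs), non-controllable FSCs,
sources with delayed feedback (FB) and delayed state information (SI),
induced joint pmfs, conditional probabilities and conditional mutual
information, following Huang–Kavčić–Ma, "Upper Bounds on the Capacities of
Non-Controllable Finite-State Channels with/without Feedback".

Time convention: for a horizon `N`, the channel inputs are `X_1,…,X_N`
(coordinate `x i` of `x : Fin N → X` is `X_{i+1}`), the states are
`S_0,…,S_N` (coordinate `s j` of `s : Fin (N+1) → S` is `S_j`), and the
outputs are `Y_1,…,Y_N` (coordinate `y i` is `Y_{i+1}`).
-/

open Finset

noncomputable section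

namespace FSCPaper

/-- Probability of an event under a pmf `p` on a finite sample space. -/
def prE {Ω : Type} [Fintype Ω] (p : Ω → ℝ) (E : Set Ω) : ℝ :=
  ∑ ω : Ω, E.indicator p ω

/-- Conditional probability `Pr(E | F)`, a ratio of (sums of) marginals
(with the `0/0 = 0` junk-value convention of real division). -/
def condPr {Ω : Type} [Fintype Ω] (p : Ω → ℝ) (E F : Set Ω) : ℝ :=
  prE p (E ∩ F) / prE p F

/-- The conditional pmf `Pr(· | F)` given an event `F`. -/
def condPMF {Ω : Type} [Fintype Ω] (p : Ω → ℝ) (F : Set Ω) : Ω → ℝ :=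
  fun ω => F.indicator p ω / prE p F

/-- Conditional mutual information `I(A;B|C)` of finite-valued random
variables `fA, fB, fC` under the pmf `p`; zero-probability terms
contribute `0` (the factor in front of the logarithm vanishes). -/
def condMI {Ω A B C : Type} [Fintype Ω] [Fintype A] [Fintype B] [Fintype C]
    (p : Ω → ℝ) (fA : Ω → A) (fB : Ω → B) (fC : Ω → C) : ℝ :=
  ∑ a : A, ∑ b : B, ∑ c : C,
    prE p {ω | fA ω = a ∧ fB ω = b ∧ fC ω = c} *
      Real.log (condPr p {ω | fA ω = a ∧ fB ω = b} {ω | fC ω = c} /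
        (condPr p {ω | fA ω = a} {ω | fC ω = c} *
          condPr p {ω | fB ω = b} {ω | fC ω = c}))

/-- Trajectories `(x_1^N, s_0^N, y_1^N)`. -/
abbrev Traj (X S Y : Type) (N : ℕ) : Type :=
  (Fin N → X) × (Fin (N + 1) → S) × (Fin N → Y)

/-- A general finite-state channel: channel transition kernel
`W(y, s' | x, s)` (a pmf on `Y × S` for each `(x,s)`) and initial state
pmf `init`. -/
structure FSC (X S Y : Type) [Fintype S] [Fintype Y] : Type where
  W : Y → S → X → S → ℝ
  init : S → ℝ
  W_nonneg : ∀ y s' x s, 0 ≤ W y s' x s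
  W_sum : ∀ x s, (∑ y : Y, ∑ s' : S, W y s' x s) = 1
  init_nonneg : ∀ s, 0 ≤ init s
  init_sum : (∑ s : S, init s) = 1

/-- A source without feedback: conditional pmfs `π_t(x_t | x^{t-1})`;
`pol t x a` is the probability that `X_{t+1} = a` given that the previous
inputs are the corresponding coordinates of `x` (by `causal` it depends
only on the coordinates `x j` with `j < t`). -/
structure FFSource (X : Type) [Fintype X] (N : ℕ) : Type where
  pol : Fin N → (Fin N → X) → X → ℝ
  nonneg : ∀ t x a, 0 ≤ pol t x a
  sum_one : ∀ t x, (∑ a : X, pol t x a) = 1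
  causal : ∀ (t : Fin N) (x x' : Fin N → X),
    (∀ j : Fin N, (j : ℕ) < (t : ℕ) → x j = x' j) → pol t x = pol t x'

/-- A non-controllable finite-state channel: output kernel `P(y|x,s)`,
free state-transition kernel `Q(s'|s)`, and initial state pmf `init`. -/
structure NCFSC (X S Y : Type) [Fintype S] [Fintype Y] : Type where
  P : Y → X → S → ℝ
  Q : S → S → ℝ
  init : S → ℝ
  P_nonneg : ∀ y x s, 0 ≤ P y x s
  P_sum : ∀ x s, (∑ y : Y, P y x s) = 1
  Q_nonneg : ∀ s' s, 0 ≤ Q s' s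
  Q_sum : ∀ s, (∑ s' : S, Q s' s) = 1
  init_nonneg : ∀ s, 0 ≤ init s
  init_sum : (∑ s : S, init s) = 1

/-- A source with `u`-delayed feedback and `u`-delayed state information
(the set `𝒫(u,u)`): `pol t x s y a` is
`π_{t+1}(a | x^{t}, s_0^{t-u}, y^{t-u})` in 1-based time; by `causal` it
depends on `(x, s, y)` only through the coordinates
`x_1^{t}` (indices `j < t`), `s_0^{t-u}` (indices `j + u ≤ t`) and
`y_1^{t-u}` (indices `j + u + 1 ≤ t`), i.e. on the past inputs, the
`u`-delayed state information and the `u`-delayed output feedback. -/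
structure Source (X S Y : Type) [Fintype X] [Fintype S] [Fintype Y] (N u : ℕ) : Type where
  pol : Fin N → (Fin N → X) → (Fin (N + 1) → S) → (Fin N → Y) → X → ℝ
  nonneg : ∀ t x s y a, 0 ≤ pol t x s y a
  sum_one : ∀ t x s y, (∑ a : X, pol t x s y a) = 1
  causal : ∀ (t : Fin N) (x x' : Fin N → X) (s s' : Fin (N + 1) → S) (y y' : Fin N → Y),
    (∀ j : Fin N, (j : ℕ) < (t : ℕ) → x j = x' j) →
    (∀ j : Fin (N + 1), (j : ℕ) + u ≤ (t : ℕ) → s j = s' j) →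
    (∀ j : Fin N, (j : ℕ) + u + 1 ≤ (t : ℕ) → y j = y' j) →
    pol t x s y = pol t x' s' y'

variable {X S Y : Type} [Fintype X] [Fintype S] [Fintype Y]

/-- Joint pmf induced by a general FSC and a feedforward source:
`Pr(x^N, s_0^N, y^N) = μ(s_0) ∏_t π_t(x_t|x^{t-1}) W(y_t, s_t | x_t, s_{t-1})`. -/
def jointP0 {N : ℕ} (ch : FSC X S Y) (src : FFSource X N) (ω : Traj X S Y N) : ℝ :=
  ch.init (ω.2.1 0) *
    ∏ i : Fin N,
      src.pol i ω.1 (ω.1 i) *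
        ch.W (ω.2.2 i) (ω.2.1 i.succ) (ω.1 i) (ω.2.1 i.castSucc)

/-- Joint channel transition `W(y, s' | x, s) = P(y|x,s) · Q(s'|s)` of a
non-controllable FSC. -/
def NCFSC.W (ch : NCFSC X S Y) (y : Y) (s' : S) (x : X) (s : S) : ℝ :=
  ch.P y x s * ch.Q s' s

/-- Joint pmf induced by a non-controllable FSC and a source in `𝒫(u,u)`:
`Pr(x^N, s_0^N, y^N) = μ(s_0) ∏_t π_t(x_t|x^{t-1},s_0^{t-u-1},y^{t-u-1}) W(y_t,s_t|x_t,s_{t-1})`. -/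
def jointP {N u : ℕ} (ch : NCFSC X S Y) (src : Source X S Y N u) (ω : Traj X S Y N) : ℝ :=
  ch.init (ω.2.1 0) *
    ∏ i : Fin N,
      src.pol i ω.1 ω.2.1 ω.2.2 (ω.1 i) *
        ch.W (ω.2.2 i) (ω.2.1 i.succ) (ω.1 i) (ω.2.1 i.castSucc)

/-- A source in `𝒫(u,u)` is a `v`-th order conditional Markov source
(the set `𝒫_v(u,u)`) if each policy depends on its arguments only through
`(x_{t-v}^{t-1}, s_{t-v-1}^{t-u-1}, y^{t-u-1})` (windows truncated for
small `t`). -/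
def IsMarkov {N u : ℕ} (v : ℕ) (src : Source X S Y N u) : Prop :=
  ∀ (t : Fin N) (x x' : Fin N → X) (s s' : Fin (N + 1) → S) (y y' : Fin N → Y),
    (∀ j : Fin N, (t : ℕ) ≤ (j : ℕ) + v ∧ (j : ℕ) < (t : ℕ) → x j = x' j) →
    (∀ j : Fin (N + 1), (t : ℕ) ≤ (j : ℕ) + v ∧ (j : ℕ) + u ≤ (t : ℕ) → s j = s' j) →
    (∀ j : Fin N, (j : ℕ) + u + 1 ≤ (t : ℕ) → y j = y' j) →
    src.pol t x s y = src.pol t x' s' y'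

/-- `Σ_{t=1}^N I(X^t, S_0^{t-v-1}; Y_t | Y^{t-1})` under the joint law of
the source (state window omitted/truncated when `t - v - 1 < 0`). -/
def objFull {N u : ℕ} (v : ℕ) (ch : NCFSC X S Y) (src : Source X S Y N u) : ℝ :=
  ∑ t : Fin N,
    condMI (jointP ch src)
      (fun ω : Traj X S Y N =>
        ((fun j : {j : Fin N // (j : ℕ) ≤ (t : ℕ)} => ω.1 j.1),
          fun j : {j : Fin (N + 1) // (j : ℕ) + v ≤ (t : ℕ)} => ω.2.1 j.1))
      (fun ω => ω.2.2 t)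
      (fun ω => fun j : {j : Fin N // (j : ℕ) < (t : ℕ)} => ω.2.2 j.1)

/-- `Σ_{t=1}^N I(X_{t-v}^t, S_{t-v-1}; Y_t | Y^{t-1})` under the joint law
of the source (windows truncated for small `t`; the singleton state window
`S_{t-v-1}` is encoded by the condition `j + v = t - 1` in 0-based time and
is empty for `t ≤ v`). -/
def objWin {N u : ℕ} (v : ℕ) (ch : NCFSC X S Y) (src : Source X S Y N u) : ℝ :=
  ∑ t : Fin N,
    condMI (jointP ch src)
      (fun ω : Traj X S Y N =>
        ((fun j : {j : Fin N // (t : ℕ) ≤ (j : ℕ) + v ∧ (j : ℕ) ≤ (t : ℕ)} => ω.1 j.1),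
          fun j : {j : Fin (N + 1) // (j : ℕ) + v = (t : ℕ)} => ω.2.1 j.1))
      (fun ω => ω.2.2 t)
      (fun ω => fun j : {j : Fin N // (j : ℕ) < (t : ℕ)} => ω.2.2 j.1)

/-- Directed information `I(X^N → Y^N) = Σ_{t=1}^N I(X^t; Y_t | Y^{t-1})`. -/
def directedInfo {N u : ℕ} (ch : NCFSC X S Y) (src : Source X S Y N u) : ℝ :=
  ∑ t : Fin N,
    condMI (jointP ch src)
      (fun ω : Traj X S Y N => fun j : {j : Fin N // (j : ℕ) ≤ (t : ℕ)} => ω.1 j.1)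
      (fun ω => ω.2.2 t)
      (fun ω => fun j : {j : Fin N // (j : ℕ) < (t : ℕ)} => ω.2.2 j.1)

/-- The a posteriori vectors `α_{t-1}(y^{t-u-1})` and `α_{t-1}(ỹ^{t-u-1})`
(at the 1-based time `(t:ℕ)+1`) induced by the two output histories `yh`
and `yh'` coincide: for all window values `(x_{t-v}^{t-1}, s_{t-v-1}^{t-u-1})`
the two a posteriori probabilities agree. -/
def alphaWinEq {N u : ℕ} (v : ℕ) (ch : NCFSC X S Y) (src : Source X S Y N u)
    (t : Fin N) (yh yh' : Fin N → Y) : Prop :=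
  ∀ (xf : Fin N → X) (sf : Fin (N + 1) → S),
    condPr (jointP ch src)
        {ω : Traj X S Y N |
          (∀ j : Fin N, (t : ℕ) ≤ (j : ℕ) + v ∧ (j : ℕ) < (t : ℕ) → ω.1 j = xf j) ∧
            ∀ j : Fin (N + 1), (t : ℕ) ≤ (j : ℕ) + v ∧ (j : ℕ) + u ≤ (t : ℕ) → ω.2.1 j = sf j}
        {ω : Traj X S Y N | ∀ j : Fin N, (j : ℕ) + u + 1 ≤ (t : ℕ) → ω.2.2 j = yh j} =
      condPr (jointP ch src)
        {ω : Traj X S Y N |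
          (∀ j : Fin N, (t : ℕ) ≤ (j : ℕ) + v ∧ (j : ℕ) < (t : ℕ) → ω.1 j = xf j) ∧
            ∀ j : Fin (N + 1), (t : ℕ) ≤ (j : ℕ) + v ∧ (j : ℕ) + u ≤ (t : ℕ) → ω.2.1 j = sf j}
        {ω : Traj X S Y N | ∀ j : Fin N, (j : ℕ) + u + 1 ≤ (t : ℕ) → ω.2.2 j = yh' j}

/-- The set `𝒫'_v(u,u)`: the policy at each time gives the same value on
any two positive-probability output histories inducing the same a
posteriori vector. -/
def AlphaPolicy {N u : ℕ} (v : ℕ) (ch : NCFSC X S Y) (src : Source X S Y N u) : Prop :=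
  ∀ (t : Fin N) (yh yh' : Fin N → Y),
    0 < prE (jointP ch src)
        {ω : Traj X S Y N | ∀ j : Fin N, (j : ℕ) + u + 1 ≤ (t : ℕ) → ω.2.2 j = yh j} →
    0 < prE (jointP ch src)
        {ω : Traj X S Y N | ∀ j : Fin N, (j : ℕ) + u + 1 ≤ (t : ℕ) → ω.2.2 j = yh' j} →
    alphaWinEq v ch src t yh yh' →
    ∀ (xf : Fin N → X) (sf : Fin (N + 1) → S) (a : X),
      src.pol t xf sf yh a = src.pol t xf sf yh' a

theorem lens_sum {Ω A : Type} [Fintype Ω] [Fintype A] (get : Ω → A) (put : A → Ω → Ω)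
    (h1 : ∀ a ω, get (put a ω) = a) (h2 : ∀ ω, put (get ω) ω = ω)
    (h3 : ∀ a b ω, put a (put b ω) = put a ω) (h : Ω → ℝ) :
    (Fintype.card A : ℝ) * ∑ ω, h ω = ∑ ω, ∑ a, h (put a ω) := by
  have e : ∑ p : Ω × A, h (put p.2 p.1) = ∑ p : Ω × A, h p.1 := by
    refine Finset.sum_bij' (fun p _ => (put p.2 p.1, get p.1)) (fun p _ => (put p.2 p.1, get p.1))
      ?_ ?_ ?_ ?_ ?_
    · simp
    · simp
    · rintro ⟨ω, a⟩ _
      simp [h1, h2, h3]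
    · rintro ⟨ω, a⟩ _
      simp [h1, h2, h3]
    · simp
  rw [Fintype.sum_prod_type, Fintype.sum_prod_type] at e
  rw [e]
  simp [Finset.mul_sum]

theorem lens_step {Ω A : Type} [Fintype Ω] [Fintype A] (get : Ω → A) (put : A → Ω → Ω)
    (h1 : ∀ a ω, get (put a ω) = a) (h2 : ∀ ω, put (get ω) ω = ω)
    (h3 : ∀ a b ω, put a (put b ω) = put a ω) (h K : Ω → ℝ)
    (hh : ∀ a ω, h (put a ω) = h ω) (hK : ∀ ω, ∑ a, K (put a ω) = 1) :
    (Fintype.card A : ℝ) * ∑ ω, h ω * K ω = ∑ ω, h ω := by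
  rw [lens_sum get put h1 h2 h3]
  refine Finset.sum_congr rfl fun ω _ => ?_
  simp only [hh]
  rw [← Finset.mul_sum, hK, mul_one]

theorem W_sum_one (ch : NCFSC X S Y) (x : X) (s : S) :
    ∑ b : S, ∑ c : Y, ch.W c b x s = 1 := by
  simp only [NCFSC.W, ← Finset.sum_mul, ch.P_sum, one_mul, ch.Q_sum]

/-- One factor of the joint law. -/
def fac {N u : ℕ} (ch : NCFSC X S Y) (src : Source X S Y N u) (i : Fin N)
    (ω : Traj X S Y N) : ℝ :=
  src.pol i ω.1 ω.2.1 ω.2.2 (ω.1 i) *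
        ch.W (ω.2.2 i) (ω.2.1 i.succ) (ω.1 i) (ω.2.1 i.castSucc)

/-- Partial joint law up to time `n`. -/
def partJ {N u : ℕ} (ch : NCFSC X S Y) (src : Source X S Y N u) (n : ℕ)
    (ω : Traj X S Y N) : ℝ :=
  ch.init (ω.2.1 0) * ∏ i ∈ univ.filter (fun i : Fin N => (i : ℕ) < n), fac ch src i ω

/-- Product of the channel factors in the time window `[a, n)`. -/
def partB {N : ℕ} (ch : NCFSC X S Y) (a n : ℕ) (ω : Traj X S Y N) : ℝ :=
  ∏ i ∈ univ.filter (fun i : Fin N => (i : ℕ) < n),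
    if a ≤ (i : ℕ) then ch.W (ω.2.2 i) (ω.2.1 i.succ) (ω.1 i) (ω.2.1 i.castSucc) else 1

theorem filter_succ {N n : ℕ} (hn : n < N) :
    univ.filter (fun i : Fin N => (i : ℕ) < n + 1)
      = insert ⟨n, hn⟩ (univ.filter (fun i : Fin N => (i : ℕ) < n)) := by
  ext i
  simp only [mem_filter, mem_univ, true_and, mem_insert, Fin.ext_iff]
  omega

theorem partJ_succ {N u : ℕ} (ch : NCFSC X S Y) (src : Source X S Y N u) (n : ℕ) (hn : n < N)
    (ω : Traj X S Y N) :
    partJ ch src (n + 1) ω = partJ ch src n ω * fac ch src ⟨n, hn⟩ ω := by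
  unfold partJ
  rw [filter_succ hn, Finset.prod_insert (by simp)]
  ring

theorem partB_succ {N : ℕ} (ch : NCFSC X S Y) (a n : ℕ) (han : a ≤ n) (hn : n < N)
    (ω : Traj X S Y N) :
    partB ch a (n + 1) ω = partB ch a n ω *
      ch.W (ω.2.2 ⟨n, hn⟩) (ω.2.1 (Fin.succ ⟨n, hn⟩)) (ω.1 ⟨n, hn⟩)
        (ω.2.1 (Fin.castSucc ⟨n, hn⟩)) := by
  unfold partB
  rw [filter_succ hn, Finset.prod_insert (by simp), if_pos han]
  ring

/-- Overwrite `x_n, s_{n+1}, y_n`. -/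
def put3 {N : ℕ} (n : Fin N) (p : X × S × Y) (ω : Traj X S Y N) : Traj X S Y N :=
  (Function.update ω.1 n p.1, Function.update ω.2.1 n.succ p.2.1, Function.update ω.2.2 n p.2.2)

/-- Overwrite `s_{n+1}, y_n`. -/
def put2 {N : ℕ} (n : Fin N) (p : S × Y) (ω : Traj X S Y N) : Traj X S Y N :=
  (ω.1, Function.update ω.2.1 n.succ p.1, Function.update ω.2.2 n p.2)

theorem stepJ {N u : ℕ} (ch : NCFSC X S Y) (src : Source X S Y N u) (n : ℕ) (hn : n < N)
    (h : Traj X S Y N → ℝ) (hh : ∀ p ω, h (put3 ⟨n, hn⟩ p ω) = h ω) :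
    (Fintype.card (X × S × Y) : ℝ) * ∑ ω, h ω * partJ ch src (n + 1) ω
      = ∑ ω, h ω * partJ ch src n ω := by
  have key := lens_step (fun ω : Traj X S Y N =>
      (ω.1 ⟨n, hn⟩, ω.2.1 (Fin.succ ⟨n, hn⟩), ω.2.2 ⟨n, hn⟩)) (put3 ⟨n, hn⟩)
      (by intro a ω; simp [put3]) (by intro ω; simp [put3]) (by intro a b ω; simp [put3])
      (fun ω => h ω * partJ ch src n ω) (fun ω => fac ch src ⟨n, hn⟩ ω) ?_ ?_
  · rw [← key]
    congr 1
    refine Finset.sum_congr rfl fun ω _ => ?_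
    rw [partJ_succ ch src n hn, mul_assoc]
  · intro p ω
    simp only [hh]
    congr 1
    unfold partJ
    congr 1
    refine Finset.prod_congr rfl fun i hi => ?_
    simp only [mem_filter, mem_univ, true_and] at hi
    have e1 : i ≠ ⟨n, hn⟩ := by intro h; simp [Fin.ext_iff] at h; omega
    have e2 : i.succ ≠ Fin.succ ⟨n, hn⟩ := by intro h; simp [Fin.ext_iff] at h; omega
    have e3 : i.castSucc ≠ Fin.succ ⟨n, hn⟩ := by intro h; simp [Fin.ext_iff] at h; omega
    have := src.causal i (put3 ⟨n, hn⟩ p ω).1 ω.1 (put3 ⟨n, hn⟩ p ω).2.1 ω.2.1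
      (put3 ⟨n, hn⟩ p ω).2.2 ω.2.2
      (fun j hj => Function.update_of_ne (by intro h; simp [Fin.ext_iff] at h; omega) _ _)
      (fun j hj => Function.update_of_ne (by intro h; simp [Fin.ext_iff] at h; omega) _ _)
      (fun j hj => Function.update_of_ne (by intro h; simp [Fin.ext_iff] at h; omega) _ _)
    unfold fac
    rw [this]
    simp only [put3, Function.update_of_ne e1, Function.update_of_ne e2, Function.update_of_ne e3]
  · intro ω
    have e3 : Fin.castSucc ⟨n, hn⟩ ≠ Fin.succ ⟨n, hn⟩ := by
      intro h; simp [Fin.ext_iff] at h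
    have : ∀ p : X × S × Y, fac ch src ⟨n, hn⟩ (put3 ⟨n, hn⟩ p ω)
        = src.pol ⟨n, hn⟩ ω.1 ω.2.1 ω.2.2 p.1 *
          ch.W p.2.2 p.2.1 p.1 (ω.2.1 (Fin.castSucc ⟨n, hn⟩)) := by
      intro p
      have := src.causal ⟨n, hn⟩ (put3 ⟨n, hn⟩ p ω).1 ω.1 (put3 ⟨n, hn⟩ p ω).2.1 ω.2.1
        (put3 ⟨n, hn⟩ p ω).2.2 ω.2.2
        (fun j hj => Function.update_of_ne (by intro h; simp [Fin.ext_iff] at h hj; omega) _ _)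
        (fun j hj => Function.update_of_ne (by intro h; simp [Fin.ext_iff] at h hj; omega) _ _)
        (fun j hj => Function.update_of_ne (by intro h; simp [Fin.ext_iff] at h hj; omega) _ _)
      unfold fac
      rw [this]
      simp only [put3, Function.update_self, Function.update_of_ne e3]
    simp only [this]
    rw [Fintype.sum_prod_type]
    simp only [← Finset.mul_sum]
    simp only [Fintype.sum_prod_type, W_sum_one, mul_one]
    exact src.sum_one _ _ _ _

theorem stepB {N : ℕ} (ch : NCFSC X S Y) (a n : ℕ) (han : a ≤ n) (hn : n < N)
    (h : Traj X S Y N → ℝ) (hh : ∀ p ω, h (put2 ⟨n, hn⟩ p ω) = h ω) :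
    (Fintype.card (S × Y) : ℝ) * ∑ ω, h ω * partB ch a (n + 1) ω
      = ∑ ω, h ω * partB ch a n ω := by
  have key := lens_step (fun ω : Traj X S Y N =>
      (ω.2.1 (Fin.succ ⟨n, hn⟩), ω.2.2 ⟨n, hn⟩)) (put2 ⟨n, hn⟩)
      (by intro a ω; simp [put2]) (by intro ω; simp [put2]) (by intro a b ω; simp [put2])
      (fun ω => h ω * partB ch a n ω) (fun ω => ch.W (ω.2.2 ⟨n, hn⟩) (ω.2.1 (Fin.succ ⟨n, hn⟩))
        (ω.1 ⟨n, hn⟩) (ω.2.1 (Fin.castSucc ⟨n, hn⟩))) ?_ ?_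
  · rw [← key]
    congr 1
    refine Finset.sum_congr rfl fun ω _ => ?_
    rw [partB_succ ch a n han hn, mul_assoc]
  · intro p ω
    simp only [hh]
    congr 1
    unfold partB
    refine Finset.prod_congr rfl fun i hi => ?_
    simp only [mem_filter, mem_univ, true_and] at hi
    have e1 : i ≠ ⟨n, hn⟩ := by intro h; simp [Fin.ext_iff] at h; omega
    have e2 : i.succ ≠ Fin.succ ⟨n, hn⟩ := by intro h; simp [Fin.ext_iff] at h; omega
    have e3 : i.castSucc ≠ Fin.succ ⟨n, hn⟩ := by intro h; simp [Fin.ext_iff] at h; omega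
    simp only [put2, Function.update_of_ne e1, Function.update_of_ne e2, Function.update_of_ne e3]
  · intro ω
    have e3 : Fin.castSucc ⟨n, hn⟩ ≠ Fin.succ ⟨n, hn⟩ := by
      intro h; simp [Fin.ext_iff] at h
    simp only [put2, Function.update_self, Function.update_of_ne e3, Fintype.sum_prod_type,
      W_sum_one]

theorem iterJ {N u : ℕ} (ch : NCFSC X S Y) (src : Source X S Y N u) (T k : ℕ) (hk : T + k ≤ N)
    (h : Traj X S Y N → ℝ)
    (hh : ∀ n (hn : n < N), T ≤ n → ∀ p ω, h (put3 ⟨n, hn⟩ p ω) = h ω) :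
    (Fintype.card (X × S × Y) : ℝ) ^ k * ∑ ω, h ω * partJ ch src (T + k) ω
      = ∑ ω, h ω * partJ ch src T ω := by
  induction k with
  | zero => simp
  | succ k ih =>
    rw [← ih (by omega), ← stepJ ch src (T + k) (by omega) h (hh _ _ (by omega)), pow_succ,
      mul_assoc, add_assoc]

theorem iterB {N : ℕ} (ch : NCFSC X S Y) (a k : ℕ) (hk : a + k ≤ N)
    (h : Traj X S Y N → ℝ)
    (hh : ∀ n (hn : n < N), a ≤ n → n < a + k → ∀ p ω, h (put2 ⟨n, hn⟩ p ω) = h ω) :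
    (Fintype.card (S × Y) : ℝ) ^ k * ∑ ω, h ω * partB ch a (a + k) ω = ∑ ω, h ω := by
  induction k with
  | zero =>
    simp only [pow_zero, one_mul, add_zero]
    refine Finset.sum_congr rfl fun ω _ => ?_
    rw [partB, Finset.prod_eq_one, mul_one]
    intro i hi
    simp only [mem_filter, mem_univ, true_and] at hi
    rw [if_neg (by omega)]
  | succ k ih =>
    rw [← ih (by omega) (fun n hn h1 h2 => hh n hn h1 (by omega)),
      ← stepB ch a (a + k) (by omega) (by omega) h (hh _ _ (by omega) (by omega)), pow_succ,
      mul_assoc, add_assoc]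

theorem partJ_full {N u : ℕ} (ch : NCFSC X S Y) (src : Source X S Y N u) (ω : Traj X S Y N) :
    partJ ch src N ω = jointP ch src ω := by
  unfold partJ jointP fac
  congr 1
  rw [Finset.filter_true_of_mem (fun i _ => i.isLt)]

/-- Overwrite the block `s_{a+1}, …, s_{a+u}` and `y_a, …, y_{a+u-1}`. -/
def putB {N : ℕ} (a u : ℕ) (p : (Fin u → S) × (Fin u → Y)) (ω : Traj X S Y N) :
    Traj X S Y N :=
  (ω.1,
    fun j => if h : a < (j : ℕ) ∧ (j : ℕ) ≤ a + u then p.1 ⟨(j : ℕ) - a - 1, by omega⟩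
      else ω.2.1 j,
    fun j => if h : a ≤ (j : ℕ) ∧ (j : ℕ) < a + u then p.2 ⟨(j : ℕ) - a, by omega⟩
      else ω.2.2 j)

theorem putB_sum {N : ℕ} (a u : ℕ) (hN : a + u ≤ N) (h : Traj X S Y N → ℝ) :
    (Fintype.card (S × Y) : ℝ) ^ u * ∑ ω, h ω = ∑ ω, ∑ p, h (putB a u p ω) := by
  have := lens_sum (fun ω : Traj X S Y N =>
    ((fun k : Fin u => ω.2.1 ⟨a + k + 1, by omega⟩), (fun k : Fin u => ω.2.2 ⟨a + k, by omega⟩)))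
    (putB a u) ?_ ?_ ?_ h
  · rw [← this]
    simp [mul_pow]
  · rintro ⟨g, b⟩ ω
    simp only [putB]
    refine Prod.ext ?_ ?_
    · funext k
      have := k.isLt
      simp only
      rw [dif_pos (by omega)]
      congr 1
      ext
      simp only
      omega
    · funext k
      have := k.isLt
      simp only
      rw [dif_pos (by omega)]
      congr 1
      ext
      simp only
      omega
  · intro ω
    simp only [putB]
    refine Prod.ext rfl (Prod.ext ?_ ?_)
    · funext j
      simp only
      split_ifs with hj
      · refine congrArg ω.2.1 (Fin.ext ?_)
        simp only
        omega
      · rfl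
    · funext j
      simp only
      split_ifs with hj
      · refine congrArg ω.2.2 (Fin.ext ?_)
        simp only
        omega
      · rfl
  · intro p q ω
    simp only [putB]
    refine Prod.ext rfl (Prod.ext ?_ ?_)
    · funext j
      simp only
      split_ifs with hj <;> rfl
    · funext j
      simp only
      split_ifs with hj <;> rfl

theorem partB_putB {N : ℕ} (ch : NCFSC X S Y) (a u : ℕ) (hN : a + u ≤ N)
    (g : Fin u → S) (b : Fin u → Y) (ω : Traj X S Y N) :
    partB ch a (a + u) (putB a u (g, b) ω) =
      ∏ k : Fin u, ch.W (b k) (g k) (ω.1 ⟨a + k, by omega⟩)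
        (if (k : ℕ) = 0 then ω.2.1 ⟨a, by omega⟩ else g ⟨(k : ℕ) - 1, by omega⟩) := by
  unfold partB
  rw [← Finset.prod_filter]
  symm
  refine Finset.prod_bij (fun k _ => ⟨a + k, by omega⟩) ?_ ?_ ?_ ?_
  · intro k _
    simp
  · intro k _ k' _ h
    simp only [Fin.mk.injEq] at h
    ext
    omega
  · intro i hi
    simp only [mem_filter, mem_univ, true_and] at hi
    refine ⟨⟨i - a, by omega⟩, mem_univ _, ?_⟩
    ext
    simp only
    omega
  · intro k _
    have hk := k.isLt
    simp only [putB, Fin.succ_mk, Fin.castSucc_mk]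
    rw [dif_pos (by omega), dif_pos (by omega)]
    congr 1
    · congr 1
      ext
      simp only
      omega
    · congr 1
      ext
      simp only
      omega
    · by_cases h0 : (k : ℕ) = 0
      · rw [if_pos h0, dif_neg (by omega)]
        refine congrArg ω.2.1 (Fin.ext ?_)
        simp only
        omega
      · rw [if_neg h0, dif_pos (by omega)]
        congr 1
        ext
        simp only
        omega

/-- **equation (eqnY).** For a non-controllable FSC with a
source in `𝒫(u,u)`, `u ≥ 1`, and `u ≤ t ≤ N` (0-based index `t : Fin N`
of the 1-based time `(t:ℕ)+1`, so the side condition is `u ≤ (t:ℕ)+1`):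
`Pr(Y_{t-u+1}^t = y_{t-u+1}^t | X^t = x^t, S_0^{t-u} = s_0^{t-u}, Y^{t-u} = y^{t-u})
  = Σ_{s_{t-u+1}^t ∈ 𝒮^u} ∏_{τ=t-u+1}^t W(y_τ, s_τ | x_τ, s_{τ-1})`,
whenever the conditioning event has positive probability; in particular
the left-hand side is completely determined by the channel law.  Below,
`g : Fin u → S` enumerates the block `s_{t-u+1}^t` (`g k = s_{t-u+1+k}`). -/
theorem statement5 {X S Y : Type} [Fintype X] [Fintype S] [Fintype Y] {N u : ℕ}
    (ch : NCFSC X S Y) (src : Source X S Y N u)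
    (hu : 1 ≤ u) (t : Fin N) (hut : u ≤ (t : ℕ) + 1)
    (x : Fin N → X) (s : Fin (N + 1) → S) (yh yb : Fin N → Y)
    (hpos : 0 < prE (jointP ch src)
      {ω : Traj X S Y N |
        (∀ j : Fin N, (j : ℕ) ≤ (t : ℕ) → ω.1 j = x j) ∧
          (∀ j : Fin (N + 1), (j : ℕ) + u ≤ (t : ℕ) + 1 → ω.2.1 j = s j) ∧
            ∀ j : Fin N, (j : ℕ) + u ≤ (t : ℕ) → ω.2.2 j = yh j}) :
    condPr (jointP ch src)
        {ω : Traj X S Y N |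
          ∀ j : Fin N, (t : ℕ) + 1 ≤ (j : ℕ) + u ∧ (j : ℕ) ≤ (t : ℕ) → ω.2.2 j = yb j}
        {ω : Traj X S Y N |
          (∀ j : Fin N, (j : ℕ) ≤ (t : ℕ) → ω.1 j = x j) ∧
            (∀ j : Fin (N + 1), (j : ℕ) + u ≤ (t : ℕ) + 1 → ω.2.1 j = s j) ∧
              ∀ j : Fin N, (j : ℕ) + u ≤ (t : ℕ) → ω.2.2 j = yh j} =
      ∑ g : Fin u → S, ∏ k : Fin u,
        ch.W (yb ⟨(t : ℕ) + 1 - u + (k : ℕ), by have := t.isLt; have := k.isLt; omega⟩)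
          (g k)
          (x ⟨(t : ℕ) + 1 - u + (k : ℕ), by have := t.isLt; have := k.isLt; omega⟩)
          (if (k : ℕ) = 0 then s ⟨(t : ℕ) + 1 - u, by have := t.isLt; omega⟩
            else g ⟨(k : ℕ) - 1, by have := k.isLt; omega⟩) := by
  classical
  obtain ⟨a, ha⟩ : ∃ a, a = (t : ℕ) + 1 - u := ⟨_, rfl⟩
  have haT : a + u = (t : ℕ) + 1 := by omega
  have htN := t.isLt
  simp only [← ha]
  set F : Set (Traj X S Y N) := {ω : Traj X S Y N |
        (∀ j : Fin N, (j : ℕ) ≤ (t : ℕ) → ω.1 j = x j) ∧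
          (∀ j : Fin (N + 1), (j : ℕ) + u ≤ (t : ℕ) + 1 → ω.2.1 j = s j) ∧
            ∀ j : Fin N, (j : ℕ) + u ≤ (t : ℕ) → ω.2.2 j = yh j} with hF
  set E : Set (Traj X S Y N) := {ω : Traj X S Y N |
          ∀ j : Fin N, (t : ℕ) + 1 ≤ (j : ℕ) + u ∧ (j : ℕ) ≤ (t : ℕ) → ω.2.2 j = yb j} with hE
  set R : ℝ := ∑ g : Fin u → S, ∏ k : Fin u,
        ch.W (yb ⟨a + (k : ℕ), by omega⟩) (g k) (x ⟨a + (k : ℕ), by omega⟩)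
          (if (k : ℕ) = 0 then s ⟨a, by omega⟩
            else g ⟨(k : ℕ) - 1, by omega⟩) with hR
  -- invariances
  have inv3F : ∀ n (hn : n < N), a + u ≤ n → ∀ p ω, put3 ⟨n, hn⟩ p ω ∈ F ↔ ω ∈ F := by
    intro n hn han p ω
    simp only [hF, Set.mem_ofPred_eq, put3]
    refine and_congr ?_ (and_congr ?_ ?_) <;> refine forall_congr' fun j => imp_congr_right fun hj => ?_ <;>
      rw [Function.update_of_ne (by intro h; simp [Fin.ext_iff] at h; omega)]
  have inv3E : ∀ n (hn : n < N), a + u ≤ n → ∀ p ω, put3 ⟨n, hn⟩ p ω ∈ E ↔ ω ∈ E := by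
    intro n hn han p ω
    simp only [hE, Set.mem_ofPred_eq, put3]
    refine forall_congr' fun j => imp_congr_right fun hj => ?_
    rw [Function.update_of_ne (by intro h; simp [Fin.ext_iff] at h; omega)]
  have inv2F : ∀ n (hn : n < N), a ≤ n → n < a + u → ∀ p ω, put2 ⟨n, hn⟩ p ω ∈ F ↔ ω ∈ F := by
    intro n hn han _ p ω
    simp only [hF, Set.mem_ofPred_eq, put2]
    refine and_congr Iff.rfl (and_congr ?_ ?_) <;> refine forall_congr' fun j => imp_congr_right fun hj => ?_ <;>
      rw [Function.update_of_ne (by intro h; simp [Fin.ext_iff] at h; omega)]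
  have invBF : ∀ p ω, putB a u p ω ∈ F ↔ ω ∈ F := by
    intro p ω
    simp only [hF, Set.mem_ofPred_eq, putB]
    refine and_congr Iff.rfl (and_congr ?_ ?_) <;> refine forall_congr' fun j => imp_congr_right fun hj => ?_ <;>
      rw [dif_neg (by omega)]
  have memBE : ∀ (g : Fin u → S) (b : Fin u → Y) (ω : Traj X S Y N), putB a u (g, b) ω ∈ E ↔ b = fun k : Fin u => yb ⟨a + k, by omega⟩ := by
    intro g b ω
    simp only [hE, Set.mem_ofPred_eq, putB]
    constructor
    · intro h
      funext k
      have hk := k.isLt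
      rw [← h ⟨a + k, by omega⟩ (by simp only; omega)]
      rw [dif_pos (by simp only; omega)]
      congr 1
      ext
      simp only
      omega
    · rintro rfl j hj
      rw [dif_pos (by omega)]
      refine congrArg yb (Fin.ext ?_)
      simp only
      omega
  -- factorization on F
  obtain ⟨C, hC⟩ : ∃ C : ℝ, ∀ ω ∈ F, partJ ch src (a + u) ω = C * partB ch a (a + u) ω := by
    refine ⟨ch.init (s 0) * ∏ i ∈ univ.filter (fun i : Fin N => (i : ℕ) < a + u),
      (src.pol i x s yh (x i) *
        if a ≤ (i : ℕ) then 1 else ch.W (yh i) (s i.succ) (x i) (s i.castSucc)), ?_⟩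
    rintro ω ⟨hx, hs, hy⟩
    unfold partJ partB fac
    rw [mul_assoc, ← Finset.prod_mul_distrib, hs 0 (by simp; omega)]
    congr 1
    refine Finset.prod_congr rfl fun i hi => ?_
    simp only [mem_filter, mem_univ, true_and] at hi
    rw [src.causal i ω.1 x ω.2.1 s ω.2.2 yh (fun j hj => hx j (by omega))
      (fun j hj => hs j (by omega)) (fun j hj => hy j (by omega)), hx i (by omega)]
    split_ifs with hai
    · ring
    · rw [hy i (by omega), hs i.succ (by simp; omega), hs i.castSucc (by simp; omega)]
      ring
  -- general reduction
  have red : ∀ G : Set (Traj X S Y N), G ⊆ F →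
      (∀ n (hn : n < N), a + u ≤ n → ∀ p ω, put3 ⟨n, hn⟩ p ω ∈ G ↔ ω ∈ G) →
      (Fintype.card (X × S × Y) : ℝ) ^ (N - (a + u)) * prE (jointP ch src) G
        = C * ∑ ω, G.indicator 1 ω * partB ch a (a + u) ω := by
    intro G hGF hG
    have h1 := iterJ ch src (a + u) (N - (a + u)) (by omega) (fun ω => G.indicator 1 ω) (by
      intro n hn hTn p ω
      simp only [Set.indicator_apply, hG n hn hTn p ω, Pi.one_apply])
    rw [show a + u + (N - (a + u)) = N by omega] at h1
    have h2 : prE (jointP ch src) G = ∑ ω, G.indicator 1 ω * partJ ch src N ω := by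
      unfold prE
      refine Finset.sum_congr rfl fun ω _ => ?_
      rw [partJ_full]
      by_cases h : ω ∈ G <;> simp [h]
    rw [h2, h1, Finset.mul_sum]
    refine Finset.sum_congr rfl fun ω _ => ?_
    by_cases h : ω ∈ G
    · simp [h, hC ω (hGF h)]
    · simp [h]
  have hden := red F subset_rfl inv3F
  have hnum := red (E ∩ F) Set.inter_subset_right (fun n hn h p ω =>
    and_congr (inv3E n hn h p ω) (inv3F n hn h p ω))
  have hB := iterB ch a u (by omega) (fun ω => F.indicator 1 ω) (by
      intro n hn h1 h2 p ω
      simp only [Set.indicator_apply, inv2F n hn h1 h2 p ω, Pi.one_apply])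
  have hA : (Fintype.card (S × Y) : ℝ) ^ u *
      ∑ ω, (E ∩ F).indicator 1 ω * partB ch a (a + u) ω = (∑ ω, F.indicator 1 ω) * R := by
    rw [putB_sum a u (by omega), Finset.sum_mul]
    refine Finset.sum_congr rfl fun ω _ => ?_
    by_cases h : ω ∈ F
    · rw [Fintype.sum_prod_type, Set.indicator_of_mem h, Pi.one_apply, one_mul, hR]
      refine Finset.sum_congr rfl fun g _ => ?_
      rw [Finset.sum_eq_single (fun k : Fin u => yb ⟨a + k, by omega⟩)]
      · rw [Set.indicator_of_mem (Set.mem_inter ((memBE _ _ _).2 rfl) ((invBF _ _).2 h)), Pi.one_apply, one_mul,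
          partB_putB ch a u (by omega)]
        refine Finset.prod_congr rfl fun k _ => ?_
        rw [h.1 ⟨a + k, by omega⟩ (by simp only; omega),
          h.2.1 ⟨a, by omega⟩ (by simp only; omega)]
      · intro b _ hb
        rw [Set.indicator_of_notMem, zero_mul]
        exact fun hm => hb ((memBE _ _ _).1 hm.1)
      · simp
    · rw [Set.indicator_of_notMem h, zero_mul]
      refine Finset.sum_eq_zero fun p _ => ?_
      rw [Set.indicator_of_notMem, zero_mul]
      exact fun hm => h ((invBF _ _).1 hm.2)
  have : Nonempty X := ⟨x t⟩
  have : Nonempty S := ⟨s 0⟩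
  have : Nonempty Y := ⟨yh t⟩
  have hc : (Fintype.card (X × S × Y) : ℝ) ≠ 0 := Nat.cast_ne_zero.2 Fintype.card_ne_zero
  have hd : (Fintype.card (S × Y) : ℝ) ≠ 0 := Nat.cast_ne_zero.2 Fintype.card_ne_zero
  unfold condPr
  rw [div_eq_iff hpos.ne']
  apply mul_left_cancel₀ (mul_ne_zero (pow_ne_zero u hd) (pow_ne_zero (N - (a + u)) hc))
  calc _ = (Fintype.card (S × Y) : ℝ) ^ u *
        ((Fintype.card (X × S × Y) : ℝ) ^ (N - (a + u)) * prE (jointP ch src) (E ∩ F)) := by ring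
    _ = C * ((Fintype.card (S × Y) : ℝ) ^ u *
      ∑ ω, (E ∩ F).indicator 1 ω * partB ch a (a + u) ω) := by rw [hnum]; ring
    _ = R * ((Fintype.card (S × Y) : ℝ) ^ u *
        (C * ∑ ω, F.indicator 1 ω * partB ch a (a + u) ω)) := by rw [hA, ← hB]; ring
    _ = _ := by rw [← hden]; ring

end FSCPaper
end
end

section
/- Theorem 2 (construction lemma): Let 0 ≤ u ≤ v and let P1 be any source in 𝒫(u,u). Define a v-th order conditional Markov source P2 ∈ 𝒫_v(u,u) by π^{P2}_t(x_t | x^{t-1}, s_0^{t-u-1}, y^{t-u-1}) := Pr^{P1}(X_t = x_t | X_{t-v}^{t-1} = x_{t-v}^{t-1}, S_{t-v-1}^{t-u-1} = s_{t-v-1}^{t-u-1}, Y^{t-u-1} = y^{t-u-1}) for t > v (the induced conditional under the joint law of P1, defined arbitrarily as a pmf on conditioning events of P1-probability zero), and π^{P2}_t := π^{P1}_t for t ≤ v. Then for every t ∈ {1,…,N} and all (x_{t-v}^t, s_{t-v-1}, y^t) (windows truncated for small t): Pr^{P2}(X_{t-v}^t = x_{t-v}^t, S_{t-v-1} = s_{t-v-1},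 Y^t = y^t) = Pr^{P1}(X_{t-v}^t = x_{t-v}^t, S_{t-v-1} = s_{t-v-1}, Y^t = y^t). Consequently, for every t the two sources yield the same value of I(X_{t-v}^t, S_{t-v-1}; Y_t | Y^{t-1}). -/
/-!
Common framework: finite-state channels (FSCs), non-controllable FSCs,
sources with delayed feedback (FB) and delayed state information (SI),
induced joint pmfs, conditional probabilities and conditional mutual
information, following Huang–Kavčić–Ma, "Upper Bounds on the Capacities of
Non-Controllable Finite-State Channels with/without Feedback".

Time convention: for a horizon `N`, the channel inputs are `X_1,…,X_N`
(coordinate `x i` of `x : Fin N → X` is `X_{i+1}`), the states are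
`S_0,…,S_N` (coordinate `s j` of `s : Fin (N+1) → S` is `S_j`), and the
outputs are `Y_1,…,Y_N` (coordinate `y i` is `Y_{i+1}`).
-/

open Finset

noncomputable section

namespace FSCPaper

variable {X S Y : Type} [Fintype X] [Fintype S] [Fintype Y]

/-- Averaging over one coordinate. -/
lemma sum_avg {Ω B : Type} [Fintype Ω] [Fintype B] (upd : Ω → B → Ω) (get : Ω → B)
    (h1 : ∀ ω b, get (upd ω b) = b) (h2 : ∀ ω b, upd (upd ω b) (get ω) = ω) (F : Ω → ℝ) :
    ∑ ω, F ω = ∑ ω, ((Fintype.card B : ℝ)⁻¹ * ∑ b, F (upd ω b)) := by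
  have hinv : Function.Involutive (fun p : Ω × B => (upd p.1 p.2, get p.1)) := by
    rintro ⟨ω, b⟩
    simp [h1, h2]
  have h := Equiv.sum_comp hinv.toPerm (fun p : Ω × B => F p.1)
  simp only [Function.Involutive.coe_toPerm, Fintype.sum_prod_type] at h
  rw [← Finset.mul_sum, h]
  simp only [Finset.sum_const, Finset.card_univ, nsmul_eq_mul, ← Finset.mul_sum]
  rcases isEmpty_or_nonempty B with hB | hB
  · have : IsEmpty Ω := ⟨fun ω => hB.false (get ω)⟩
    simp
  · have : (Fintype.card B : ℝ) ≠ 0 := by exact_mod_cast Fintype.card_ne_zero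
    field_simp

/-- Change the input coordinate `k`. -/
def updX {N : ℕ} (k : Fin N) (ω : Traj X S Y N) (a : X) : Traj X S Y N :=
  (Function.update ω.1 k a, ω.2)

/-- Change the output coordinate `k` and the following state. -/
def updSY {N : ℕ} (k : Fin N) (ω : Traj X S Y N) (b : S × Y) : Traj X S Y N :=
  (ω.1, Function.update ω.2.1 k.succ b.1, Function.update ω.2.2 k b.2)

/-- Product of the truncated weights. -/
def rw' {N u : ℕ} (ch : NCFSC X S Y) (src : Source X S Y N u) (a m : ℕ)
    (ω : Traj X S Y N) : ℝ :=
  ch.init (ω.2.1 0) *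
    (∏ i : Fin N, if (i : ℕ) < a then src.pol i ω.1 ω.2.1 ω.2.2 (ω.1 i)
      else (Fintype.card X : ℝ)⁻¹) *
    ∏ i : Fin N, if (i : ℕ) < m then
        ch.W (ω.2.2 i) (ω.2.1 i.succ) (ω.1 i) (ω.2.1 i.castSucc)
      else (Fintype.card (S × Y) : ℝ)⁻¹

lemma rw'_full {N u : ℕ} (ch : NCFSC X S Y) (src : Source X S Y N u) (ω : Traj X S Y N) :
    jointP ch src ω = rw' ch src N N ω := by
  simp [jointP, rw', Finset.prod_mul_distrib, mul_assoc]

lemma W_nonneg' (ch : NCFSC X S Y) (y : Y) (s' : S) (x : X) (s : S) : 0 ≤ ch.W y s' x s :=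
  mul_nonneg (ch.P_nonneg _ _ _) (ch.Q_nonneg _ _)

lemma W_sum' (ch : NCFSC X S Y) (x : X) (s : S) :
    ∑ b : S × Y, ch.W b.2 b.1 x s = 1 := by
  rw [Fintype.sum_prod_type]
  simp only [NCFSC.W]
  simp only [← Finset.sum_mul, ch.P_sum, one_mul, ch.Q_sum]

lemma rw'_nonneg {N u : ℕ} (ch : NCFSC X S Y) (src : Source X S Y N u) (a m : ℕ)
    (ω : Traj X S Y N) : 0 ≤ rw' ch src a m ω := by
  refine mul_nonneg (mul_nonneg (ch.init_nonneg _) (Finset.prod_nonneg ?_))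
    (Finset.prod_nonneg ?_)
  · intro i _
    split_ifs
    · exact src.nonneg _ _ _ _ _
    · positivity
  · intro i _
    split_ifs
    · exact W_nonneg' _ _ _ _ _
    · positivity

lemma stepX {N u : ℕ} (ch : NCFSC X S Y) (src : Source X S Y N u) (a : Fin N) (m : ℕ)
    (hm : m ≤ (a : ℕ)) (F : Traj X S Y N → ℝ) (hF : ∀ ω b, F (updX a ω b) = F ω) (g : X → ℝ) :
    ∑ ω, rw' ch src ((a : ℕ) + 1) m ω * (F ω * g (ω.1 a)) =
      ∑ ω, rw' ch src a m ω * (F ω * ∑ b, src.pol a ω.1 ω.2.1 ω.2.2 b * g b) := by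
  classical
  set D : Traj X S Y N → ℝ := fun ω => ch.init (ω.2.1 0) *
    (∏ i ∈ Finset.univ.erase a, if (i : ℕ) < a then src.pol i ω.1 ω.2.1 ω.2.2 (ω.1 i)
      else (Fintype.card X : ℝ)⁻¹) *
    ∏ i : Fin N, if (i : ℕ) < m then
        ch.W (ω.2.2 i) (ω.2.1 i.succ) (ω.1 i) (ω.2.1 i.castSucc)
      else (Fintype.card (S × Y) : ℝ)⁻¹ with hD
  have hDu : ∀ ω b, D (updX a ω b) = D ω := by
    intro ω b
    simp only [hD, updX]
    congr 1
    · congr 1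
      refine Finset.prod_congr rfl fun i hi => ?_
      split_ifs with h
      · have hne : i ≠ a := Finset.ne_of_mem_erase hi
        rw [Function.update_of_ne hne]
        refine congrFun (src.causal i _ _ _ _ _ _ ?_ (fun _ _ => rfl) (fun _ _ => rfl)) _
        intro j hj
        rw [Function.update_of_ne]
        rintro rfl
        omega
      · rfl
    · refine Finset.prod_congr rfl fun i hi => ?_
      split_ifs with h
      · rw [Function.update_of_ne]
        rintro rfl
        omega
      · rfl
  have hpolu : ∀ ω b, src.pol a (updX a ω b).1 (updX a ω b).2.1 (updX a ω b).2.2 =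
      src.pol a ω.1 ω.2.1 ω.2.2 := by
    intro ω b
    refine src.causal a _ _ _ _ _ _ ?_ (fun _ _ => rfl) (fun _ _ => rfl)
    intro j hj
    simp only [updX]
    rw [Function.update_of_ne]
    rintro rfl
    omega
  have e1 : ∀ ω, rw' ch src ((a : ℕ) + 1) m ω =
      D ω * src.pol a ω.1 ω.2.1 ω.2.2 (ω.1 a) := by
    intro ω
    simp only [rw', hD]
    rw [← Finset.mul_prod_erase _ _ (Finset.mem_univ a)]
    have : (∏ i ∈ Finset.univ.erase a, if (i : ℕ) < (a : ℕ) + 1 then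
        src.pol i ω.1 ω.2.1 ω.2.2 (ω.1 i) else (Fintype.card X : ℝ)⁻¹) =
        ∏ i ∈ Finset.univ.erase a, if (i : ℕ) < a then src.pol i ω.1 ω.2.1 ω.2.2 (ω.1 i)
        else (Fintype.card X : ℝ)⁻¹ := by
      refine Finset.prod_congr rfl fun i hi => ?_
      have hne : (i : ℕ) ≠ a := fun h => Finset.ne_of_mem_erase hi (Fin.ext h)
      exact if_congr (by omega) rfl rfl
    rw [this, if_pos (Nat.lt_succ_self _)]
    ring
  have e2 : ∀ ω, rw' ch src (a : ℕ) m ω = D ω * (Fintype.card X : ℝ)⁻¹ := by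
    intro ω
    simp only [rw', hD]
    rw [← Finset.mul_prod_erase _ _ (Finset.mem_univ a), if_neg (lt_irrefl _)]
    ring
  simp only [e1, e2]
  rw [sum_avg (updX a) (fun ω => ω.1 a) (by intro ω b; simp [updX])
    (by intro ω b; simp [updX])]
  refine Finset.sum_congr rfl fun ω _ => ?_
  simp only [hDu, hF, hpolu]
  simp only [updX, Function.update_self, Finset.mul_sum]
  refine Finset.sum_congr rfl fun b _ => ?_
  ring

lemma stepSY {N u : ℕ} (ch : NCFSC X S Y) (src : Source X S Y N u) (m : Fin N) (a : ℕ)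
    (hm : a ≤ (m : ℕ) + 1 + u) (F : Traj X S Y N → ℝ) (hF : ∀ ω b, F (updSY m ω b) = F ω)
    (g : S → Y → ℝ) :
    ∑ ω, rw' ch src a ((m : ℕ) + 1) ω * (F ω * g (ω.2.1 m.succ) (ω.2.2 m)) =
      ∑ ω, rw' ch src a m ω *
        (F ω * ∑ b : S × Y, ch.W b.2 b.1 (ω.1 m) (ω.2.1 m.castSucc) * g b.1 b.2) := by
  classical
  set D : Traj X S Y N → ℝ := fun ω => ch.init (ω.2.1 0) *
    (∏ i : Fin N, if (i : ℕ) < a then src.pol i ω.1 ω.2.1 ω.2.2 (ω.1 i)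
      else (Fintype.card X : ℝ)⁻¹) *
    ∏ i ∈ Finset.univ.erase m, if (i : ℕ) < m then
        ch.W (ω.2.2 i) (ω.2.1 i.succ) (ω.1 i) (ω.2.1 i.castSucc)
      else (Fintype.card (S × Y) : ℝ)⁻¹ with hD
  have hs : ∀ (ω : Traj X S Y N) (b : S × Y) (j : Fin (N + 1)), (j : ℕ) ≤ m →
      (updSY m ω b).2.1 j = ω.2.1 j := by
    intro ω b j hj
    simp only [updSY]
    rw [Function.update_of_ne]
    rintro rfl
    simp at hj
  have hy : ∀ (ω : Traj X S Y N) (b : S × Y) (j : Fin N), (j : ℕ) < m →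
      (updSY m ω b).2.2 j = ω.2.2 j := by
    intro ω b j hj
    simp only [updSY]
    rw [Function.update_of_ne]
    rintro rfl
    simp at hj
  have hDu : ∀ ω b, D (updSY m ω b) = D ω := by
    intro ω b
    simp only [hD]
    rw [hs ω b 0 (by simp)]
    congr 1
    · congr 1
      refine Finset.prod_congr rfl fun i hi => ?_
      split_ifs with h
      · refine congrFun (src.causal i _ _ _ _ _ _ (fun _ _ => rfl) ?_ ?_) _
        · intro j hj
          exact hs _ _ _ (by omega)
        · intro j hj
          exact hy _ _ _ (by omega)
      · rfl
    · refine Finset.prod_congr rfl fun i hi => ?_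
      split_ifs with h
      · rw [hs _ _ _ (by simpa using h), hs _ _ _ (by simpa using h.le), hy _ _ _ h]
        rfl
      · rfl
  have e1 : ∀ ω, rw' ch src a ((m : ℕ) + 1) ω =
      D ω * ch.W (ω.2.2 m) (ω.2.1 m.succ) (ω.1 m) (ω.2.1 m.castSucc) := by
    intro ω
    simp only [rw', hD]
    rw [← Finset.mul_prod_erase (a := m) Finset.univ
      (fun i : Fin N => if (i : ℕ) < (m : ℕ) + 1 then
        ch.W (ω.2.2 i) (ω.2.1 i.succ) (ω.1 i) (ω.2.1 i.castSucc)
      else (Fintype.card (S × Y) : ℝ)⁻¹) (Finset.mem_univ m)]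
    have : (∏ i ∈ Finset.univ.erase m, if (i : ℕ) < (m : ℕ) + 1 then
        ch.W (ω.2.2 i) (ω.2.1 i.succ) (ω.1 i) (ω.2.1 i.castSucc)
        else (Fintype.card (S × Y) : ℝ)⁻¹) =
        ∏ i ∈ Finset.univ.erase m, if (i : ℕ) < m then
        ch.W (ω.2.2 i) (ω.2.1 i.succ) (ω.1 i) (ω.2.1 i.castSucc)
        else (Fintype.card (S × Y) : ℝ)⁻¹ := by
      refine Finset.prod_congr rfl fun i hi => ?_
      have hne : (i : ℕ) ≠ m := fun h => Finset.ne_of_mem_erase hi (Fin.ext h)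
      exact if_congr (by omega) rfl rfl
    rw [this, if_pos (Nat.lt_succ_self _)]
    ring
  have e2 : ∀ ω, rw' ch src a (m : ℕ) ω = D ω * (Fintype.card (S × Y) : ℝ)⁻¹ := by
    intro ω
    simp only [rw', hD]
    rw [← Finset.mul_prod_erase (a := m) Finset.univ
      (fun i : Fin N => if (i : ℕ) < (m : ℕ) then
        ch.W (ω.2.2 i) (ω.2.1 i.succ) (ω.1 i) (ω.2.1 i.castSucc)
      else (Fintype.card (S × Y) : ℝ)⁻¹) (Finset.mem_univ m), if_neg (lt_irrefl _)]
    ring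
  simp only [e1, e2]
  rw [sum_avg (updSY m) (fun ω => (ω.2.1 m.succ, ω.2.2 m)) (by intro ω b; simp [updSY])
    (by intro ω b; simp [updSY])]
  refine Finset.sum_congr rfl fun ω _ => ?_
  have hc : ∀ b, (updSY m ω b).2.1 m.castSucc = ω.2.1 m.castSucc := fun b =>
    hs _ _ _ (by simp)
  simp only [hDu, hF, hc]
  simp only [updSY, Function.update_self, Finset.mul_sum]
  refine Finset.sum_congr rfl fun b _ => ?_
  ring

lemma stepX_one {N u : ℕ} (ch : NCFSC X S Y) (src : Source X S Y N u) (a : Fin N) (m : ℕ)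
    (hm : m ≤ (a : ℕ)) (F : Traj X S Y N → ℝ) (hF : ∀ ω b, F (updX a ω b) = F ω) :
    ∑ ω, rw' ch src ((a : ℕ) + 1) m ω * F ω = ∑ ω, rw' ch src a m ω * F ω := by
  simpa [src.sum_one] using stepX ch src a m hm F hF (fun _ => 1)

lemma stepSY_one {N u : ℕ} (ch : NCFSC X S Y) (src : Source X S Y N u) (m : Fin N) (a : ℕ)
    (hm : a ≤ (m : ℕ) + 1 + u) (F : Traj X S Y N → ℝ) (hF : ∀ ω b, F (updSY m ω b) = F ω) :
    ∑ ω, rw' ch src a ((m : ℕ) + 1) ω * F ω = ∑ ω, rw' ch src a m ω * F ω := by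
  simpa [W_sum'] using stepSY ch src m a hm F hF (fun _ _ => 1)

lemma tail {N u : ℕ} (ch : NCFSC X S Y) (src : Source X S Y N u) (k : ℕ) (hk : k ≤ N)
    (F : Traj X S Y N → ℝ) (hX : ∀ i : Fin N, k ≤ (i : ℕ) → ∀ ω b, F (updX i ω b) = F ω)
    (hSY : ∀ i : Fin N, k ≤ (i : ℕ) → ∀ ω b, F (updSY i ω b) = F ω) :
    ∑ ω, jointP ch src ω * F ω = ∑ ω, rw' ch src k k ω * F ω := by
  simp only [rw'_full]
  have key : ∀ d, k + d ≤ N →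
      ∑ ω, rw' ch src (k + d) (k + d) ω * F ω = ∑ ω, rw' ch src k k ω * F ω := by
    intro d
    induction d with
    | zero => intro _; rfl
    | succ d ih =>
      intro hd
      rw [← ih (by omega)]
      have h1 := stepSY_one ch src ⟨k + d, by omega⟩ (k + d + 1) (by simp) F
        (hSY _ (by simp))
      have h2 := stepX_one ch src ⟨k + d, by omega⟩ (k + d) le_rfl F (hX _ (by simp))
      exact h1.trans h2
  have := key (N - k) (by omega)
  rwa [Nat.add_sub_cancel' hk] at this

open Classical in
/-- Real-valued indicator of a proposition. -/
def ind (p : Prop) : ℝ := if p then 1 else 0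

lemma ind_and (p q : Prop) : ind (p ∧ q) = ind p * ind q := by
  unfold ind
  by_cases hp : p <;> by_cases hq : q <;> simp [hp, hq]

lemma ind_nonneg (p : Prop) : 0 ≤ ind p := by
  unfold ind
  split_ifs <;> norm_num

lemma prE_eq {Ω : Type} [Fintype Ω] (p : Ω → ℝ) (E : Set Ω) :
    prE p E = ∑ ω, p ω * ind (ω ∈ E) := by
  unfold prE ind
  refine Finset.sum_congr rfl fun ω _ => ?_
  by_cases h : ω ∈ E <;> simp [h]

lemma ind_mul_congr {p : Prop} {a b : ℝ} (h : p → a = b) : ind p * a = ind p * b := by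
  unfold ind
  split_ifs with hp
  · rw [h hp]
  · simp

/-- Marginalization: laws agreeing on the classes of an equivalence relation agree on
functions invariant under it. -/
lemma marg {Ω : Type} [Fintype Ω] (R : Ω → Ω → Prop) (hR : Equivalence R) (p p' : Ω → ℝ)
    (h : ∀ ω0, ∑ ω, p ω * ind (R ω ω0) = ∑ ω, p' ω * ind (R ω ω0))
    (G : Ω → ℝ) (hG : ∀ ω ω', R ω ω' → G ω = G ω') :
    ∑ ω, p ω * G ω = ∑ ω, p' ω * G ω := by
  classical
  let st : Setoid Ω := ⟨R, hR⟩
  have key : ∀ q : Ω → ℝ, ∑ ω, q ω * G ω =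
      ∑ c : Quotient st, (∑ ω, q ω * ind (R ω c.out)) * G c.out := by
    intro q
    simp only [Finset.sum_mul]
    rw [Finset.sum_comm]
    refine Finset.sum_congr rfl fun ω _ => ?_
    rw [Finset.sum_eq_single (Quotient.mk st ω)]
    · have h1 : R ω (Quotient.mk st ω).out := hR.symm (Quotient.mk_out (s := st) ω)
      rw [← hG _ _ h1]
      simp [ind, h1]
    · intro c _ hc
      have : ¬ R ω c.out := by
        intro h1
        apply hc
        rw [← Quotient.out_eq c]
        exact (Quotient.sound (s := st) h1).symm
      simp [ind, this]
    · simp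
  rw [key, key]
  simp only [h]

lemma marg_prE {Ω : Type} [Fintype Ω] (R : Ω → Ω → Prop) (hR : Equivalence R) (p p' : Ω → ℝ)
    (h : ∀ ω0, prE p {ω | R ω ω0} = prE p' {ω | R ω ω0})
    (E : Set Ω) (hE : ∀ ω ω', R ω ω' → (ω ∈ E ↔ ω' ∈ E)) :
    prE p E = prE p' E := by
  simp only [prE_eq] at h ⊢
  exact marg R hR p p' h _ fun ω ω' h1 => by rw [hE ω ω' h1]

/-- Agreement of the windows. -/
def RC {N : ℕ} (v k m : ℕ) (ω ω' : Traj X S Y N) : Prop :=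
  (∀ j : Fin N, k ≤ (j : ℕ) + v ∧ (j : ℕ) < k → ω.1 j = ω'.1 j) ∧
    (∀ j : Fin (N + 1), k ≤ (j : ℕ) + v ∧ (j : ℕ) ≤ m → ω.2.1 j = ω'.2.1 j) ∧
      ∀ j : Fin N, (j : ℕ) < m → ω.2.2 j = ω'.2.2 j

/-- Agreement of the windows including the next step. -/
def RB {N : ℕ} (v : ℕ) (k : Fin N) (ω ω' : Traj X S Y N) : Prop :=
  RC v k k ω ω' ∧ ω.1 k = ω'.1 k ∧ ω.2.1 k.succ = ω'.2.1 k.succ ∧ ω.2.2 k = ω'.2.2 k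

lemma RB_equiv {N : ℕ} (v : ℕ) (k : Fin N) :
    Equivalence (RB (X := X) (S := S) (Y := Y) v k) where
  refl _ := ⟨⟨fun _ _ => rfl, fun _ _ => rfl, fun _ _ => rfl⟩, rfl, rfl, rfl⟩
  symm h := ⟨⟨fun j hj => (h.1.1 j hj).symm, fun j hj => (h.1.2.1 j hj).symm,
    fun j hj => (h.1.2.2 j hj).symm⟩, h.2.1.symm, h.2.2.1.symm, h.2.2.2.symm⟩
  trans h g := ⟨⟨fun j hj => (h.1.1 j hj).trans (g.1.1 j hj),
    fun j hj => (h.1.2.1 j hj).trans (g.1.2.1 j hj),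
    fun j hj => (h.1.2.2 j hj).trans (g.1.2.2 j hj)⟩, h.2.1.trans g.2.1,
    h.2.2.1.trans g.2.2.1, h.2.2.2.trans g.2.2.2⟩

lemma RC_updX {N : ℕ} (v k m : ℕ) (i : Fin N) (hi : k ≤ (i : ℕ)) (ω ω0 : Traj X S Y N) (b : X) :
    RC v k m (updX i ω b) ω0 ↔ RC v k m ω ω0 := by
  have : ∀ j : Fin N, (j : ℕ) < k → (updX i ω b).1 j = ω.1 j := by
    intro j hj
    simp only [updX]
    rw [Function.update_of_ne]
    rintro rfl
    omega
  unfold RC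
  refine and_congr (forall_congr' fun j => forall_congr' fun hj => ?_) Iff.rfl
  rw [this j hj.2]

lemma updSY_s {N : ℕ} (i : Fin N) (ω : Traj X S Y N) (b : S × Y) (j : Fin (N + 1))
    (hj : (j : ℕ) ≤ i) : (updSY i ω b).2.1 j = ω.2.1 j := by
  simp only [updSY]
  rw [Function.update_of_ne]
  rintro rfl
  simp at hj

lemma updSY_y {N : ℕ} (i : Fin N) (ω : Traj X S Y N) (b : S × Y) (j : Fin N)
    (hj : (j : ℕ) < i) : (updSY i ω b).2.2 j = ω.2.2 j := by
  simp only [updSY]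
  rw [Function.update_of_ne]
  rintro rfl
  simp at hj

lemma RC_updSY {N : ℕ} (v k m : ℕ) (i : Fin N) (hi : m ≤ (i : ℕ)) (ω ω0 : Traj X S Y N)
    (b : S × Y) :
    RC v k m (updSY i ω b) ω0 ↔ RC v k m ω ω0 := by
  unfold RC
  refine and_congr Iff.rfl (and_congr (forall_congr' fun j => forall_congr' fun hj => ?_)
    (forall_congr' fun j => forall_congr' fun hj => ?_))
  · rw [updSY_s i ω b j (by omega)]
  · rw [updSY_y i ω b j (by omega)]

lemma pol_updX {N u : ℕ} (src : Source X S Y N u) (k i : Fin N) (hi : (k : ℕ) ≤ (i : ℕ))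
    (ω : Traj X S Y N) (b : X) :
    src.pol k (updX i ω b).1 (updX i ω b).2.1 (updX i ω b).2.2 =
      src.pol k ω.1 ω.2.1 ω.2.2 := by
  refine src.causal k _ _ _ _ _ _ ?_ (fun _ _ => rfl) (fun _ _ => rfl)
  intro j hj
  simp only [updX]
  rw [Function.update_of_ne]
  rintro rfl
  omega

lemma pol_updSY {N u : ℕ} (src : Source X S Y N u) (k i : Fin N) (hi : (k : ℕ) ≤ (i : ℕ) + u)
    (ω : Traj X S Y N) (b : S × Y) :
    src.pol k (updSY i ω b).1 (updSY i ω b).2.1 (updSY i ω b).2.2 =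
      src.pol k ω.1 ω.2.1 ω.2.2 := by
  refine src.causal k _ _ _ _ _ _ (fun _ _ => rfl) ?_ ?_
  · intro j hj
    exact updSY_s _ _ _ _ (by omega)
  · intro j hj
    exact updSY_y _ _ _ _ (by omega)

lemma RC_succ {N : ℕ} (v k : ℕ) (m : Fin N) (hm : k ≤ (m : ℕ) + 1 + v) (ω ω0 : Traj X S Y N) :
    RC v k ((m : ℕ) + 1) ω ω0 ↔
      RC v k m ω ω0 ∧ (ω.2.1 m.succ = ω0.2.1 m.succ ∧ ω.2.2 m = ω0.2.2 m) := by
  constructor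
  · rintro ⟨h1, h2, h3⟩
    exact ⟨⟨h1, fun j hj => h2 j (by omega), fun j hj => h3 j (by omega)⟩,
      h2 _ (by simp; omega), h3 _ (by simp)⟩
  · rintro ⟨⟨h1, h2, h3⟩, h4, h5⟩
    refine ⟨h1, fun j hj => ?_, fun j hj => ?_⟩
    · by_cases hjm : (j : ℕ) ≤ m
      · exact h2 j ⟨hj.1, hjm⟩
      · have : j = m.succ := Fin.ext (by simp; omega)
        rw [this, h4]
    · by_cases hjm : (j : ℕ) < m
      · exact h3 j hjm
      · have : j = m := Fin.ext (by omega)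
        rw [this, h5]

lemma sum_W_ind (ch : NCFSC X S Y) (x : X) (s s0 : S) (y0 : Y) :
    ∑ b : S × Y, ch.W b.2 b.1 x s * ind (b.1 = s0 ∧ b.2 = y0) = ch.W y0 s0 x s := by
  classical
  rw [Finset.sum_eq_single (s0, y0)]
  · simp [ind]
  · rintro ⟨b1, b2⟩ _ hb
    have : ¬ (b1 = s0 ∧ b2 = y0) := by
      rintro ⟨rfl, rfl⟩
      exact hb rfl
    simp [ind, this]
  · simp

lemma sum_pol_ind (f : X → ℝ) (x0 : X) : ∑ b : X, f b * ind (b = x0) = f x0 := by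
  classical
  rw [Finset.sum_eq_single x0]
  · simp [ind]
  · intro b _ hb
    simp [ind, hb]
  · simp

lemma peel {N u : ℕ} (ch : NCFSC X S Y) (src : Source X S Y N u) (v k : ℕ) (huv : u ≤ v)
    (m : Fin N) (hmk : (m : ℕ) < k) (hkm : k ≤ (m : ℕ) + u) (ω0 : Traj X S Y N)
    (H : Traj X S Y N → ℝ) (hH : ∀ ω b, H (updSY m ω b) = H ω) :
    ∑ ω, rw' ch src k ((m : ℕ) + 1) ω * (ind (RC v k ((m : ℕ) + 1) ω ω0) * H ω) =
      ch.W (ω0.2.2 m) (ω0.2.1 m.succ) (ω0.1 m) (ω0.2.1 m.castSucc) *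
        ∑ ω, rw' ch src k m ω * (ind (RC v k m ω ω0) * H ω) := by
  have h := stepSY ch src m k (by omega) (fun ω => ind (RC v k m ω ω0) * H ω)
    (by intro ω b; rw [RC_updSY v k m m le_rfl, hH])
    (fun s y => ind (s = ω0.2.1 m.succ ∧ y = ω0.2.2 m))
  simp only [sum_W_ind] at h
  have e : ∀ ω, ind (RC v k ((m : ℕ) + 1) ω ω0) * H ω = ind (RC v k m ω ω0) * H ω *
      ind (ω.2.1 m.succ = ω0.2.1 m.succ ∧ ω.2.2 m = ω0.2.2 m) := by
    intro ω
    rw [RC_succ v k m (by omega), ind_and]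
    ring
  simp only [e, h, Finset.mul_sum]
  refine Finset.sum_congr rfl fun ω _ => ?_
  have : ind (RC v k m ω ω0) * ch.W (ω0.2.2 m) (ω0.2.1 m.succ) (ω.1 m) (ω.2.1 m.castSucc) =
      ind (RC v k m ω ω0) *
        ch.W (ω0.2.2 m) (ω0.2.1 m.succ) (ω0.1 m) (ω0.2.1 m.castSucc) := by
    refine ind_mul_congr fun h => ?_
    rw [h.1 m ⟨by omega, hmk⟩, h.2.1 m.castSucc (by simp; omega)]
  linear_combination (rw' ch src k m ω * H ω) * this

lemma kappa {N u : ℕ} (ch : NCFSC X S Y) (src : Source X S Y N u) (v k : ℕ) (huv : u ≤ v)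
    (huk : u ≤ k) (hkN : k ≤ N) (ω0 : Traj X S Y N) :
    ∃ κ : ℝ, ∀ H : Traj X S Y N → ℝ,
      (∀ i : Fin N, k ≤ (i : ℕ) + u → ∀ ω b, H (updSY i ω b) = H ω) →
      ∑ ω, rw' ch src k k ω * (ind (RC v k k ω ω0) * H ω) =
        κ * ∑ ω, rw' ch src k (k - u) ω * (ind (RC v k (k - u) ω ω0) * H ω) := by
  have key : ∀ d, d ≤ u → ∃ κ : ℝ, ∀ H : Traj X S Y N → ℝ,
      (∀ i : Fin N, k ≤ (i : ℕ) + u → ∀ ω b, H (updSY i ω b) = H ω) →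
      ∑ ω, rw' ch src k (k - u + d) ω * (ind (RC v k (k - u + d) ω ω0) * H ω) =
        κ * ∑ ω, rw' ch src k (k - u) ω * (ind (RC v k (k - u) ω ω0) * H ω) := by
    intro d
    induction d with
    | zero => intro _; exact ⟨1, fun H _ => by simp⟩
    | succ d ih =>
      intro hd
      obtain ⟨κ, hκ⟩ := ih (by omega)
      have hm : k - u + d < N := by omega
      refine ⟨ch.W (ω0.2.2 ⟨_, hm⟩) (ω0.2.1 (Fin.succ ⟨_, hm⟩)) (ω0.1 ⟨_, hm⟩)
        (ω0.2.1 (Fin.castSucc ⟨_, hm⟩)) * κ, fun H hH => ?_⟩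
      have h := peel ch src v k huv ⟨_, hm⟩ (by simp; omega) (by simp; omega) ω0 H
        (hH _ (by simp; omega))
      rw [mul_assoc, ← hκ H hH]
      exact h
  have := key u le_rfl
  rwa [Nat.sub_add_cancel huk] at this

lemma drop {N u : ℕ} (ch : NCFSC X S Y) (src : Source X S Y N u) (k : ℕ)
    (huk : u ≤ k) (hkN : k ≤ N) (F : Traj X S Y N → ℝ)
    (hF : ∀ i : Fin N, k ≤ (i : ℕ) + u → ∀ ω b, F (updSY i ω b) = F ω) :
    ∑ ω, rw' ch src k k ω * F ω = ∑ ω, rw' ch src k (k - u) ω * F ω := by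
  have key : ∀ d, d ≤ u →
      ∑ ω, rw' ch src k (k - u + d) ω * F ω = ∑ ω, rw' ch src k (k - u) ω * F ω := by
    intro d
    induction d with
    | zero => intro _; rfl
    | succ d ih =>
      intro hd
      have hm : k - u + d < N := by omega
      rw [← ih (by omega)]
      exact stepSY_one ch src ⟨_, hm⟩ k (by simp; omega) F (hF _ (by simp; omega))
  have := key u le_rfl
  rwa [Nat.sub_add_cancel huk] at this

lemma RB_step {N u : ℕ} (ch : NCFSC X S Y) (src : Source X S Y N u) (v : ℕ) (k : Fin N)
    (ω0 : Traj X S Y N) :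
    ∑ ω, rw' ch src ((k : ℕ) + 1) ((k : ℕ) + 1) ω * ind (RB v k ω ω0) =
      ch.W (ω0.2.2 k) (ω0.2.1 k.succ) (ω0.1 k) (ω0.2.1 k.castSucc) *
        ∑ ω, rw' ch src k k ω *
          (ind (RC v k k ω ω0) * src.pol k ω.1 ω.2.1 ω.2.2 (ω0.1 k)) := by
  have h1 := stepSY ch src k ((k : ℕ) + 1) (by omega)
    (fun ω => ind (RC v k k ω ω0) * ind (ω.1 k = ω0.1 k))
    (by intro ω b; rw [RC_updSY v k k k le_rfl]; rfl)
    (fun s y => ind (s = ω0.2.1 k.succ ∧ y = ω0.2.2 k))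
  have h2 := stepX ch src k k le_rfl (fun ω => ind (RC v k k ω ω0))
    (by intro ω b; rw [RC_updX v k k k le_rfl]) (fun x => ind (x = ω0.1 k))
  simp only [sum_W_ind] at h1
  simp only [sum_pol_ind] at h2
  rw [← h2, Finset.mul_sum]
  have e : ∀ ω, ind (RB v k ω ω0) = ind (RC v k k ω ω0) * ind (ω.1 k = ω0.1 k) *
      ind (ω.2.1 k.succ = ω0.2.1 k.succ ∧ ω.2.2 k = ω0.2.2 k) := by
    intro ω
    rw [RB, ind_and, ind_and, mul_assoc]
  simp only [e, h1]
  refine Finset.sum_congr rfl fun ω _ => ?_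
  have : ind (RC v k k ω ω0 ∧ ω.1 k = ω0.1 k) *
        ch.W (ω0.2.2 k) (ω0.2.1 k.succ) (ω.1 k) (ω.2.1 k.castSucc) =
      ind (RC v k k ω ω0 ∧ ω.1 k = ω0.1 k) *
        ch.W (ω0.2.2 k) (ω0.2.1 k.succ) (ω0.1 k) (ω0.2.1 k.castSucc) := by
    refine ind_mul_congr fun h => ?_
    rw [h.2, h.1.2.1 k.castSucc (by simp)]
  rw [ind_and] at this
  linear_combination (rw' ch src ((k : ℕ) + 1) k ω) * this

lemma polStep {N u : ℕ} (ch : NCFSC X S Y) (v : ℕ) (huv : u ≤ v) (P1 P2 : Source X S Y N u)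
    (hsmall : ∀ t : Fin N, (t : ℕ) < v → P2.pol t = P1.pol t)
    (hc : ∀ t : Fin N, v ≤ (t : ℕ) → ∀ ω0 : Traj X S Y N,
      0 < prE (jointP ch P1) {ω | RC v t ((t : ℕ) - u) ω ω0} →
      ∀ a, P2.pol t ω0.1 ω0.2.1 ω0.2.2 a =
        condPr (jointP ch P1) {ω | ω.1 t = a} {ω | RC v t ((t : ℕ) - u) ω ω0})
    (k : Fin N) (ω0 : Traj X S Y N) (a : X) :
    ∑ ω, rw' ch P1 k k ω * (ind (RC v k k ω ω0) * P1.pol k ω.1 ω.2.1 ω.2.2 a) =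
      P2.pol k ω0.1 ω0.2.1 ω0.2.2 a * ∑ ω, rw' ch P1 k k ω * ind (RC v k k ω ω0) := by
  rcases lt_or_ge (k : ℕ) v with hkv | hkv
  · rw [hsmall k hkv, Finset.mul_sum]
    refine Finset.sum_congr rfl fun ω _ => ?_
    have : ind (RC v k k ω ω0) * P1.pol k ω.1 ω.2.1 ω.2.2 a =
        ind (RC v k k ω ω0) * P1.pol k ω0.1 ω0.2.1 ω0.2.2 a := by
      refine ind_mul_congr fun h => ?_
      refine congrFun (P1.causal k _ _ _ _ _ _ ?_ ?_ ?_) a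
      · exact fun j hj => h.1 j (by omega)
      · exact fun j hj => h.2.1 j (by omega)
      · exact fun j hj => h.2.2 j (by omega)
    rw [this]
    ring
  · have huk : u ≤ (k : ℕ) := huv.trans hkv
    have hkN : (k : ℕ) ≤ N := k.2.le
    obtain ⟨κ, hκ⟩ := kappa ch P1 v k huv huk hkN ω0
    have hpol : ∀ i : Fin N, (k : ℕ) ≤ (i : ℕ) + u → ∀ (ω : Traj X S Y N) b,
        (fun ω : Traj X S Y N => P1.pol k ω.1 ω.2.1 ω.2.2 a) (updSY i ω b) =
          (fun ω : Traj X S Y N => P1.pol k ω.1 ω.2.1 ω.2.2 a) ω := by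
      intro i hi ω b
      exact congrFun (pol_updSY P1 k i hi ω b) a
    have k1 := hκ (fun ω => P1.pol k ω.1 ω.2.1 ω.2.2 a) hpol
    have k2 := hκ (fun _ => 1) (fun _ _ _ _ => rfl)
    simp only [mul_one] at k2
    rw [k1, k2]
    set T1 := ∑ ω, rw' ch P1 k ((k : ℕ) - u) ω * ind (RC v k ((k : ℕ) - u) ω ω0) with hT1
    set Tp := ∑ ω, rw' ch P1 k ((k : ℕ) - u) ω *
      (ind (RC v k ((k : ℕ) - u) ω ω0) * P1.pol k ω.1 ω.2.1 ω.2.2 a) with hTp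
    have hCSY : ∀ i : Fin N, (k : ℕ) ≤ (i : ℕ) + u → ∀ (ω : Traj X S Y N) b,
        ind (RC v k ((k : ℕ) - u) (updSY i ω b) ω0) = ind (RC v k ((k : ℕ) - u) ω ω0) := by
      intro i hi ω b
      rw [RC_updSY v k _ i (by omega)]
    have hCX : ∀ i : Fin N, (k : ℕ) ≤ (i : ℕ) → ∀ (ω : Traj X S Y N) b,
        ind (RC v k ((k : ℕ) - u) (updX i ω b) ω0) = ind (RC v k ((k : ℕ) - u) ω ω0) := by
      intro i hi ω b
      rw [RC_updX v k _ i hi]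
    have e1 : prE (jointP ch P1) {ω | RC v k ((k : ℕ) - u) ω ω0} = T1 := by
      rw [prE_eq]
      simp only [Set.mem_ofPred_eq]
      rw [tail ch P1 k hkN (fun ω => ind (RC v k ((k : ℕ) - u) ω ω0)) hCX
        (fun i hi => hCSY i (by omega)),
        drop ch P1 k huk hkN (fun ω => ind (RC v k ((k : ℕ) - u) ω ω0)) hCSY]
    have e2 : prE (jointP ch P1) ({ω | ω.1 k = a} ∩ {ω | RC v k ((k : ℕ) - u) ω ω0}) = Tp := by
      rw [prE_eq]
      simp only [Set.mem_inter_iff, Set.mem_ofPred_eq, ind_and]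
      rw [tail ch P1 ((k : ℕ) + 1) k.2
        (fun ω => ind (ω.1 k = a) * ind (RC v k ((k : ℕ) - u) ω ω0))]
      · rw [stepSY_one ch P1 k _ (by omega)
          (fun ω => ind (ω.1 k = a) * ind (RC v k ((k : ℕ) - u) ω ω0))]
        · have h := stepX ch P1 k k le_rfl (fun ω => ind (RC v k ((k : ℕ) - u) ω ω0))
            (hCX k le_rfl) (fun x => ind (x = a))
          simp only [sum_pol_ind] at h
          simp only [mul_comm (ind (_ = a))]
          rw [h]
          refine drop ch P1 k huk hkN
            (fun ω => ind (RC v k ((k : ℕ) - u) ω ω0) * P1.pol k ω.1 ω.2.1 ω.2.2 a) ?_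
          intro i hi ω b
          rw [hCSY i hi, pol_updSY P1 k i hi]
        · intro ω b
          rw [hCSY k (by omega)]
          rfl
      · intro i hi ω b
        rw [hCX i (by omega)]
        have : (updX i ω b).1 k = ω.1 k := by
          simp only [updX]
          rw [Function.update_of_ne]
          rintro rfl
          omega
        rw [this]
      · intro i hi ω b
        rw [hCSY i (by omega)]
        rfl
    have hT1n : 0 ≤ T1 := Finset.sum_nonneg fun ω _ =>
      mul_nonneg (rw'_nonneg _ _ _ _ _) (ind_nonneg _)
    rcases hT1n.lt_or_eq with hpos | hzero
    · have h := hc k hkv ω0 (by rw [e1]; exact hpos) a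
      rw [h, condPr, e1, e2]
      field_simp
    · have hz : ∀ ω, rw' ch P1 k ((k : ℕ) - u) ω * ind (RC v k ((k : ℕ) - u) ω ω0) = 0 := by
        intro ω
        exact (Finset.sum_eq_zero_iff_of_nonneg (fun ω _ =>
          mul_nonneg (rw'_nonneg _ _ _ _ _) (ind_nonneg _))).1 hzero.symm ω (Finset.mem_univ ω)
      have hTp0 : Tp = 0 := by
        refine Finset.sum_eq_zero fun ω _ => ?_
        rw [← mul_assoc, hz, zero_mul]
      rw [hTp0, ← hzero]
      ring

lemma RB_eq {N u : ℕ} (ch : NCFSC X S Y) (v : ℕ) (huv : u ≤ v) (P1 P2 : Source X S Y N u)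
    (hMarkov : IsMarkov v P2)
    (hsmall : ∀ t : Fin N, (t : ℕ) < v → P2.pol t = P1.pol t)
    (hc : ∀ t : Fin N, v ≤ (t : ℕ) → ∀ ω0 : Traj X S Y N,
      0 < prE (jointP ch P1) {ω | RC v t ((t : ℕ) - u) ω ω0} →
      ∀ a, P2.pol t ω0.1 ω0.2.1 ω0.2.2 a =
        condPr (jointP ch P1) {ω | ω.1 t = a} {ω | RC v t ((t : ℕ) - u) ω ω0})
    (k : Fin N) (hA : ∀ ω0, ∑ ω, rw' ch P2 k k ω * ind (RC v k k ω ω0) =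
      ∑ ω, rw' ch P1 k k ω * ind (RC v k k ω ω0)) (ω0 : Traj X S Y N) :
    ∑ ω, rw' ch P2 ((k : ℕ) + 1) ((k : ℕ) + 1) ω * ind (RB v k ω ω0) =
      ∑ ω, rw' ch P1 ((k : ℕ) + 1) ((k : ℕ) + 1) ω * ind (RB v k ω ω0) := by
  rw [RB_step, RB_step, polStep ch v huv P1 P2 hsmall hc k ω0, ← hA ω0]
  congr 1
  rw [Finset.mul_sum]
  refine Finset.sum_congr rfl fun ω _ => ?_
  have : ind (RC v k k ω ω0) * P2.pol k ω.1 ω.2.1 ω.2.2 (ω0.1 k) =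
      ind (RC v k k ω ω0) * P2.pol k ω0.1 ω0.2.1 ω0.2.2 (ω0.1 k) := by
    refine ind_mul_congr fun h => ?_
    refine congrFun (hMarkov k _ _ _ _ _ _ ?_ ?_ ?_) _
    · exact fun j hj => h.1 j (by omega)
    · exact fun j hj => h.2.1 j (by omega)
    · exact fun j hj => h.2.2 j (by omega)
  rw [this]
  ring

lemma RC_eq {N u : ℕ} (ch : NCFSC X S Y) (v : ℕ) (huv : u ≤ v) (P1 P2 : Source X S Y N u)
    (hMarkov : IsMarkov v P2)
    (hsmall : ∀ t : Fin N, (t : ℕ) < v → P2.pol t = P1.pol t)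
    (hc : ∀ t : Fin N, v ≤ (t : ℕ) → ∀ ω0 : Traj X S Y N,
      0 < prE (jointP ch P1) {ω | RC v t ((t : ℕ) - u) ω ω0} →
      ∀ a, P2.pol t ω0.1 ω0.2.1 ω0.2.2 a =
        condPr (jointP ch P1) {ω | ω.1 t = a} {ω | RC v t ((t : ℕ) - u) ω ω0})
    (k : ℕ) (hk : k ≤ N) (ω0 : Traj X S Y N) :
    ∑ ω, rw' ch P2 k k ω * ind (RC v k k ω ω0) =
      ∑ ω, rw' ch P1 k k ω * ind (RC v k k ω ω0) := by
  induction k generalizing ω0 with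
  | zero => simp [rw']
  | succ k ih =>
    have hB := RB_eq ch v huv P1 P2 hMarkov hsmall hc ⟨k, hk⟩ (ih (by omega))
    refine marg (RB v ⟨k, hk⟩) (RB_equiv v _) _ _ hB (fun ω => ind (RC v (k + 1) (k + 1) ω ω0)) ?_
    have half : ∀ ω ω' : Traj X S Y N, RB v ⟨k, hk⟩ ω ω' → RC v (k + 1) (k + 1) ω ω' := by
      rintro ω ω' ⟨⟨h1, h2, h3⟩, h4, h5, h6⟩
      refine ⟨fun j hj => ?_, fun j hj => ?_, fun j hj => ?_⟩
      · by_cases hjk : (j : ℕ) < k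
        · exact h1 j ⟨by simp; omega, hjk⟩
        · rw [show j = ⟨k, hk⟩ from Fin.ext (by simp; omega)]
          exact h4
      · by_cases hjk : (j : ℕ) ≤ k
        · exact h2 j ⟨by simp; omega, hjk⟩
        · rw [show j = Fin.succ ⟨k, hk⟩ from Fin.ext (by simp; omega)]
          exact h5
      · by_cases hjk : (j : ℕ) < k
        · exact h3 j hjk
        · rw [show j = ⟨k, hk⟩ from Fin.ext (by simp; omega)]
          exact h6
    have tr : ∀ ω ω' : Traj X S Y N, RB v ⟨k, hk⟩ ω ω' → RC v (k + 1) (k + 1) ω' ω0 →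
        RC v (k + 1) (k + 1) ω ω0 := by
      intro ω ω' h g
      have f := half ω ω' h
      exact ⟨fun j hj => (f.1 j hj).trans (g.1 j hj),
        fun j hj => (f.2.1 j hj).trans (g.2.1 j hj),
        fun j hj => (f.2.2 j hj).trans (g.2.2 j hj)⟩
    intro ω ω' h
    congr 1
    exact propext ⟨tr ω' ω ((RB_equiv v _).symm h), tr ω ω' h⟩

/-- The relation of the statement. -/
def RG {N : ℕ} (v : ℕ) (t : Fin N) (ω ω' : Traj X S Y N) : Prop :=
  (∀ j : Fin N, (t : ℕ) ≤ (j : ℕ) + v ∧ (j : ℕ) ≤ (t : ℕ) → ω.1 j = ω'.1 j) ∧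
    (∀ j : Fin (N + 1), (j : ℕ) + v = (t : ℕ) → ω.2.1 j = ω'.2.1 j) ∧
      ∀ j : Fin N, (j : ℕ) ≤ (t : ℕ) → ω.2.2 j = ω'.2.2 j

lemma RG_equiv {N : ℕ} (v : ℕ) (t : Fin N) :
    Equivalence (RG (X := X) (S := S) (Y := Y) v t) where
  refl _ := ⟨fun _ _ => rfl, fun _ _ => rfl, fun _ _ => rfl⟩
  symm h := ⟨fun j hj => (h.1 j hj).symm, fun j hj => (h.2.1 j hj).symm,
    fun j hj => (h.2.2 j hj).symm⟩
  trans h g := ⟨fun j hj => (h.1 j hj).trans (g.1 j hj),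
    fun j hj => (h.2.1 j hj).trans (g.2.1 j hj),
    fun j hj => (h.2.2 j hj).trans (g.2.2 j hj)⟩

lemma RB_RG {N : ℕ} (v : ℕ) (t : Fin N) (ω ω' : Traj X S Y N) (h : RB v t ω ω') :
    RG v t ω ω' := by
  obtain ⟨⟨h1, h2, h3⟩, h4, h5, h6⟩ := h
  refine ⟨fun j hj => ?_, fun j hj => h2 j (by omega), fun j hj => ?_⟩
  · by_cases hjk : (j : ℕ) < t
    · exact h1 j (by omega)
    · rw [show j = t from Fin.ext (by omega)]
      exact h4
  · by_cases hjk : (j : ℕ) < t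
    · exact h3 j hjk
    · rw [show j = t from Fin.ext (by omega)]
      exact h6

lemma condMI_congr {Ω A B C : Type} [Fintype Ω] [Fintype A] [Fintype B] [Fintype C]
    (R : Ω → Ω → Prop) (hR : Equivalence R) (p p' : Ω → ℝ)
    (h : ∀ ω0, prE p {ω | R ω ω0} = prE p' {ω | R ω ω0})
    (fA : Ω → A) (fB : Ω → B) (fC : Ω → C)
    (hA : ∀ ω ω', R ω ω' → fA ω = fA ω') (hB : ∀ ω ω', R ω ω' → fB ω = fB ω')
    (hC : ∀ ω ω', R ω ω' → fC ω = fC ω') :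
    condMI p fA fB fC = condMI p' fA fB fC := by
  have m := marg_prE R hR p p' h
  unfold condMI condPr
  refine Finset.sum_congr rfl fun a _ => Finset.sum_congr rfl fun b _ =>
    Finset.sum_congr rfl fun c _ => ?_
  rw [m {ω | fA ω = a ∧ fB ω = b ∧ fC ω = c}, m {ω | fC ω = c},
    m ({ω | fA ω = a ∧ fB ω = b} ∩ {ω | fC ω = c}), m ({ω | fA ω = a} ∩ {ω | fC ω = c}),
    m ({ω | fB ω = b} ∩ {ω | fC ω = c})]
  all_goals
    intro ω ω' hω
    simp [hA ω ω' hω, hB ω ω' hω, hC ω ω' hω]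

/-- **Theorem 2, construction lemma.** Let `0 ≤ u ≤ v`, let
`P1 ∈ 𝒫(u,u)` be arbitrary, and let `P2` be any `v`-th order conditional
Markov source in `𝒫_v(u,u)` whose policy is the conditional probability
induced by `P1`:
`π^{P2}_t(x_t | …) = Pr^{P1}(X_t = x_t | X_{t-v}^{t-1}, S_{t-v-1}^{t-u-1}, Y^{t-u-1})`
for `t > v` on all conditioning events of positive `P1`-probability
(arbitrary elsewhere), and `π^{P2}_t = π^{P1}_t` for `t ≤ v`.  Then `P1`
and `P2` induce the same joint law of `(X_{t-v}^t, S_{t-v-1}, Y^t)` for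
every `t`, and consequently the same `I(X_{t-v}^t, S_{t-v-1}; Y_t | Y^{t-1})`. -/
theorem statement6 {X S Y : Type} [Fintype X] [Fintype S] [Fintype Y] {N u : ℕ}
    (ch : NCFSC X S Y) (v : ℕ) (huv : u ≤ v)
    (P1 P2 : Source X S Y N u)
    (hMarkov : IsMarkov v P2)
    (hsmall : ∀ t : Fin N, (t : ℕ) < v → P2.pol t = P1.pol t)
    (hcond : ∀ t : Fin N, v ≤ (t : ℕ) →
      ∀ (xf : Fin N → X) (sf : Fin (N + 1) → S) (yf : Fin N → Y),
        0 < prE (jointP ch P1)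
            {ω : Traj X S Y N |
              (∀ j : Fin N, (t : ℕ) ≤ (j : ℕ) + v ∧ (j : ℕ) < (t : ℕ) → ω.1 j = xf j) ∧
                (∀ j : Fin (N + 1),
                  (t : ℕ) ≤ (j : ℕ) + v ∧ (j : ℕ) + u ≤ (t : ℕ) → ω.2.1 j = sf j) ∧
                  ∀ j : Fin N, (j : ℕ) + u + 1 ≤ (t : ℕ) → ω.2.2 j = yf j} →
        ∀ a : X,
          P2.pol t xf sf yf a =
            condPr (jointP ch P1) {ω : Traj X S Y N | ω.1 t = a}
              {ω : Traj X S Y N |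
                (∀ j : Fin N, (t : ℕ) ≤ (j : ℕ) + v ∧ (j : ℕ) < (t : ℕ) → ω.1 j = xf j) ∧
                  (∀ j : Fin (N + 1),
                    (t : ℕ) ≤ (j : ℕ) + v ∧ (j : ℕ) + u ≤ (t : ℕ) → ω.2.1 j = sf j) ∧
                    ∀ j : Fin N, (j : ℕ) + u + 1 ≤ (t : ℕ) → ω.2.2 j = yf j}) :
    (∀ (t : Fin N) (xf : Fin N → X) (sf : Fin (N + 1) → S) (yf : Fin N → Y),
        prE (jointP ch P2)
            {ω : Traj X S Y N |
              (∀ j : Fin N, (t : ℕ) ≤ (j : ℕ) + v ∧ (j : ℕ) ≤ (t : ℕ) → ω.1 j = xf j) ∧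
                (∀ j : Fin (N + 1), (j : ℕ) + v = (t : ℕ) → ω.2.1 j = sf j) ∧
                  ∀ j : Fin N, (j : ℕ) ≤ (t : ℕ) → ω.2.2 j = yf j} =
          prE (jointP ch P1)
            {ω : Traj X S Y N |
              (∀ j : Fin N, (t : ℕ) ≤ (j : ℕ) + v ∧ (j : ℕ) ≤ (t : ℕ) → ω.1 j = xf j) ∧
                (∀ j : Fin (N + 1), (j : ℕ) + v = (t : ℕ) → ω.2.1 j = sf j) ∧
                  ∀ j : Fin N, (j : ℕ) ≤ (t : ℕ) → ω.2.2 j = yf j}) ∧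
      ∀ t : Fin N,
        condMI (jointP ch P2)
            (fun ω : Traj X S Y N =>
              ((fun j : {j : Fin N // (t : ℕ) ≤ (j : ℕ) + v ∧ (j : ℕ) ≤ (t : ℕ)} => ω.1 j.1),
                fun j : {j : Fin (N + 1) // (j : ℕ) + v = (t : ℕ)} => ω.2.1 j.1))
            (fun ω => ω.2.2 t)
            (fun ω => fun j : {j : Fin N // (j : ℕ) < (t : ℕ)} => ω.2.2 j.1) =
          condMI (jointP ch P1)
            (fun ω : Traj X S Y N =>
              ((fun j : {j : Fin N // (t : ℕ) ≤ (j : ℕ) + v ∧ (j : ℕ) ≤ (t : ℕ)} => ω.1 j.1),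
                fun j : {j : Fin (N + 1) // (j : ℕ) + v = (t : ℕ)} => ω.2.1 j.1))
            (fun ω => ω.2.2 t)
            (fun ω => fun j : {j : Fin N // (j : ℕ) < (t : ℕ)} => ω.2.2 j.1) := by
  have hc : ∀ t : Fin N, v ≤ (t : ℕ) → ∀ ω0 : Traj X S Y N,
      0 < prE (jointP ch P1) {ω | RC v t ((t : ℕ) - u) ω ω0} →
      ∀ a, P2.pol t ω0.1 ω0.2.1 ω0.2.2 a =
        condPr (jointP ch P1) {ω | ω.1 t = a} {ω | RC v t ((t : ℕ) - u) ω ω0} := by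
    intro t ht ω0
    have hset : {ω : Traj X S Y N | RC v t ((t : ℕ) - u) ω ω0} =
        {ω : Traj X S Y N |
          (∀ j : Fin N, (t : ℕ) ≤ (j : ℕ) + v ∧ (j : ℕ) < (t : ℕ) → ω.1 j = ω0.1 j) ∧
            (∀ j : Fin (N + 1),
              (t : ℕ) ≤ (j : ℕ) + v ∧ (j : ℕ) + u ≤ (t : ℕ) → ω.2.1 j = ω0.2.1 j) ∧
              ∀ j : Fin N, (j : ℕ) + u + 1 ≤ (t : ℕ) → ω.2.2 j = ω0.2.2 j} := by
      ext ω
      constructor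
      · rintro ⟨h1, h2, h3⟩
        exact ⟨h1, fun j hj => h2 j (by omega), fun j hj => h3 j (by omega)⟩
      · rintro ⟨h1, h2, h3⟩
        exact ⟨h1, fun j hj => h2 j (by omega), fun j hj => h3 j (by omega)⟩
    rw [hset]
    exact hcond t ht ω0.1 ω0.2.1 ω0.2.2
  have main : ∀ (t : Fin N) (ω0 : Traj X S Y N),
      prE (jointP ch P2) {ω | RG v t ω ω0} = prE (jointP ch P1) {ω | RG v t ω ω0} := by
    intro t ω0
    refine marg_prE (RB v t) (RB_equiv v t) _ _ ?_ _ ?_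
    · intro ω1
      have hX : ∀ i : Fin N, (t : ℕ) + 1 ≤ (i : ℕ) → ∀ (ω : Traj X S Y N) b,
          (fun ω => ind (RB v t ω ω1)) (updX i ω b) = (fun ω => ind (RB v t ω ω1)) ω := by
        intro i hi ω b
        simp only [RB]
        rw [RC_updX v t t i (by omega)]
        have : (updX i ω b).1 t = ω.1 t := by
          simp only [updX]
          rw [Function.update_of_ne]
          rintro rfl
          omega
        rw [this]
        rfl
      have hSY : ∀ i : Fin N, (t : ℕ) + 1 ≤ (i : ℕ) → ∀ (ω : Traj X S Y N) b,
          (fun ω => ind (RB v t ω ω1)) (updSY i ω b) = (fun ω => ind (RB v t ω ω1)) ω := by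
        intro i hi ω b
        simp only [RB]
        rw [RC_updSY v t t i (by omega), updSY_s i ω b t.succ (by simpa using hi),
          updSY_y i ω b t (by omega)]
        rfl
      simp only [prE_eq, Set.mem_ofPred_eq]
      rw [tail ch P2 ((t : ℕ) + 1) t.2 (fun ω => ind (RB v t ω ω1)) hX hSY,
        tail ch P1 ((t : ℕ) + 1) t.2 (fun ω => ind (RB v t ω ω1)) hX hSY]
      exact RB_eq ch v huv P1 P2 hMarkov hsmall hc t
        (RC_eq ch v huv P1 P2 hMarkov hsmall hc t t.2.le) ω1
    · intro ω ω' h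
      have h' := RB_RG v t ω ω' h
      exact ⟨fun g => (RG_equiv v t).trans ((RG_equiv v t).symm h') g,
        fun g => (RG_equiv v t).trans h' g⟩
  refine ⟨fun t xf sf yf => main t (xf, sf, yf), fun t => ?_⟩
  refine condMI_congr (RG v t) (RG_equiv v t) _ _ (main t) _ _ _ ?_ ?_ ?_
  · intro ω ω' h
    refine Prod.ext (funext fun j => h.1 j.1 j.2) (funext fun j => h.2.1 j.1 j.2)
  · intro ω ω' h
    exact h.2.2 t le_rfl
  · intro ω ω' h
    exact funext fun j => h.2.2 j.1 j.2.le

end FSCPaper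
end
end
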